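/- Let q be an odd prime power and let F = F_q. Then the number of K-equivalence classes of 3-dimensional F-subspaces W of Sym₃(F) that contain a nonzero matrix of rank 1 is exactly 15. (Equivalently: there are exactly 15 orbits of planes in PG(5,q) meeting the quadric Veronesean in at least one point, under the action of PGL(3,q) ≤ PGL(6,q).) -/

import Mathlib

open Matrix

/-- Two subspaces `W`, `W'` of the space of `3 × 3` matrices over `F` are `K`-equivalent
if `W' = {A * M * Aᵀ : M ∈ W}` for some invertible matrix `A`. -/
def KEquiv (F : Type*) [Field F] (W W' : Submodule F (Matrix (Fin 3) (Fin 3) F)) : Prop :=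
  ∃ A : Matrix (Fin 3) (Fin 3) F, IsUnit A ∧
    (W' : Set (Matrix (Fin 3) (Fin 3) F)) = (fun M => A * M * Aᵀ) '' (W : Set (Matrix (Fin 3) (Fin 3) F))

namespace NetsOfConics

section Basic

variable {F : Type*}

/-- The symmetric matrix with upper triangular entries `a b c d e f`. -/
def symMat (a b c d e f : F) : Matrix (Fin 3) (Fin 3) F :=
  !![a, b, c; b, d, e; c, e, f]

theorem symMat_inj {a b c d e f a' b' c' d' e' f' : F} :
    symMat a b c d e f = symMat a' b' c' d' e' f' ↔
      a = a' ∧ b = b' ∧ c = c' ∧ d = d' ∧ e = e' ∧ f = f' := by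
  constructor
  · intro h
    have h0 := congrFun (congrFun h 0)
    have h1 := congrFun (congrFun h 1)
    have h2 := congrFun (congrFun h 2)
    have a1 := h0 0
    have a2 := h0 1
    have a3 := h0 2
    have a4 := h1 1
    have a5 := h1 2
    have a6 := h2 2
    simp [symMat] at a1 a2 a3 a4 a5 a6
    exact ⟨a1, a2, a3, a4, a5, a6⟩
  · rintro ⟨rfl, rfl, rfl, rfl, rfl, rfl⟩
    rfl

theorem symMat_isSymm (a b c d e f : F) : (symMat a b c d e f).IsSymm := by
  ext i j
  fin_cases i <;> fin_cases j <;> rfl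

theorem eq_symMat {M : Matrix (Fin 3) (Fin 3) F} (h : M.IsSymm) :
    M = symMat (M 0 0) (M 0 1) (M 0 2) (M 1 1) (M 1 2) (M 2 2) := by
  ext i j
  fin_cases i <;> fin_cases j <;> simp [symMat, h.apply 0 1, h.apply 0 2, h.apply 1 2]

variable [Field F]

theorem kEquiv_symm {W W' : Submodule F (Matrix (Fin 3) (Fin 3) F)} (h : KEquiv F W W') :
    KEquiv F W' W := by
  obtain ⟨A, hA, h⟩ := h
  have hd : IsUnit A.det := (Matrix.isUnit_iff_isUnit_det A).1 hA
  refine ⟨A⁻¹, (Matrix.isUnit_nonsing_inv_iff).2 hA, ?_⟩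
  have key : ∀ M, A⁻¹ * (A * M * Aᵀ) * (A⁻¹)ᵀ = M := by
    intro M
    calc A⁻¹ * (A * M * Aᵀ) * (A⁻¹)ᵀ = (A⁻¹ * A) * M * (A⁻¹ * A)ᵀ := by
          simp only [Matrix.transpose_mul, Matrix.mul_assoc]
      _ = M := by rw [Matrix.nonsing_inv_mul _ hd]; simp
  rw [h, Set.image_image]
  simp only [key, Set.image_id']

theorem kEquiv_trans {W W' W'' : Submodule F (Matrix (Fin 3) (Fin 3) F)} (h : KEquiv F W W')
    (h' : KEquiv F W' W'') : KEquiv F W W'' := by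
  obtain ⟨A, hA, h⟩ := h
  obtain ⟨B, hB, h'⟩ := h'
  refine ⟨B * A, hB.mul hA, ?_⟩
  rw [h', h, Set.image_image]
  simp only [Matrix.transpose_mul, Matrix.mul_assoc]

theorem kEquiv_refl (W : Submodule F (Matrix (Fin 3) (Fin 3) F)) : KEquiv F W W :=
  ⟨1, isUnit_one, by simp⟩

theorem det_symMat (a b c d e f : F) :
    (symMat a b c d e f).det = a * d * f + 2 * b * c * e - a * e ^ 2 - f * b ^ 2 - d * c ^ 2 := by
  simp [symMat, Matrix.det_fin_three]
  ring

/-- The space spanned by `E₁₁` and two symmetric matrices with vanishing top left entry, each given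
by the rest of its first row and by its lower right block. -/
def net (m₁ m₂ p q r n₁ n₂ p' q' r' : F) : Submodule F (Matrix (Fin 3) (Fin 3) F) :=
  Submodule.span F {symMat 1 0 0 0 0 0, symMat 0 m₁ m₂ p q r, symMat 0 n₁ n₂ p' q' r'}

theorem comb_eq (m₁ m₂ p q r n₁ n₂ p' q' r' a b c : F) :
    a • symMat 1 0 0 0 0 0 + b • symMat 0 m₁ m₂ p q r + c • symMat 0 n₁ n₂ p' q' r' =
      symMat a (b * m₁ + c * n₁) (b * m₂ + c * n₂) (b * p + c * p') (b * q + c * q')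
        (b * r + c * r') := by
  ext i j
  fin_cases i <;> fin_cases j <;> simp [symMat]

theorem mem_net {m₁ m₂ p q r n₁ n₂ p' q' r' : F} {M : Matrix (Fin 3) (Fin 3) F} :
    M ∈ net m₁ m₂ p q r n₁ n₂ p' q' r' ↔ ∃ a b c : F,
      symMat a (b * m₁ + c * n₁) (b * m₂ + c * n₂) (b * p + c * p') (b * q + c * q')
        (b * r + c * r') = M := by
  simp only [net, Submodule.mem_span_triple, comb_eq]

/-- A block triangular congruence together with a change of basis identifies two nets. -/
theorem net_kEquiv {m₁ m₂ p q r n₁ n₂ p' q' r' M₁ M₂ P Q R N₁ N₂ P' Q' R' : F}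
    (l u₁ u₂ b₁ b₂ b₃ b₄ c₁ c₂ c₃ c₄ : F) (hl : l ≠ 0) (hb : b₁ * b₄ - b₂ * b₃ ≠ 0)
    (hc : c₁ * c₄ - c₂ * c₃ ≠ 0)
    (e₁ : b₁ * (l * m₁ + p * u₁ + q * u₂) + b₂ * (l * m₂ + q * u₁ + r * u₂) = c₁ * M₁ + c₂ * N₁)
    (e₂ : b₃ * (l * m₁ + p * u₁ + q * u₂) + b₄ * (l * m₂ + q * u₁ + r * u₂) = c₁ * M₂ + c₂ * N₂)
    (e₃ : b₁ ^ 2 * p + 2 * b₁ * b₂ * q + b₂ ^ 2 * r = c₁ * P + c₂ * P')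
    (e₄ : b₁ * b₃ * p + (b₁ * b₄ + b₂ * b₃) * q + b₂ * b₄ * r = c₁ * Q + c₂ * Q')
    (e₅ : b₃ ^ 2 * p + 2 * b₃ * b₄ * q + b₄ ^ 2 * r = c₁ * R + c₂ * R')
    (f₁ : b₁ * (l * n₁ + p' * u₁ + q' * u₂) + b₂ * (l * n₂ + q' * u₁ + r' * u₂)
      = c₃ * M₁ + c₄ * N₁)
    (f₂ : b₃ * (l * n₁ + p' * u₁ + q' * u₂) + b₄ * (l * n₂ + q' * u₁ + r' * u₂)
      = c₃ * M₂ + c₄ * N₂)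
    (f₃ : b₁ ^ 2 * p' + 2 * b₁ * b₂ * q' + b₂ ^ 2 * r' = c₃ * P + c₄ * P')
    (f₄ : b₁ * b₃ * p' + (b₁ * b₄ + b₂ * b₃) * q' + b₂ * b₄ * r' = c₃ * Q + c₄ * Q')
    (f₅ : b₃ ^ 2 * p' + 2 * b₃ * b₄ * q' + b₄ ^ 2 * r' = c₃ * R + c₄ * R') :
    KEquiv F (net m₁ m₂ p q r n₁ n₂ p' q' r') (net M₁ M₂ P Q R N₁ N₂ P' Q' R') := by
  set A : Matrix (Fin 3) (Fin 3) F := !![l, u₁, u₂; 0, b₁, b₂; 0, b₃, b₄] with hA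
  let φ : F → F → F := fun b c =>
    b * (2 * l * (u₁ * m₁ + u₂ * m₂) + u₁ ^ 2 * p + 2 * u₁ * u₂ * q + u₂ ^ 2 * r) +
    c * (2 * l * (u₁ * n₁ + u₂ * n₂) + u₁ ^ 2 * p' + 2 * u₁ * u₂ * q' + u₂ ^ 2 * r')
  have key : ∀ a b c : F,
      A * symMat a (b * m₁ + c * n₁) (b * m₂ + c * n₂) (b * p + c * p') (b * q + c * q')
        (b * r + c * r') * Aᵀ =
      symMat (l ^ 2 * a + φ b c)
        ((b * c₁ + c * c₃) * M₁ + (b * c₂ + c * c₄) * N₁)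
        ((b * c₁ + c * c₃) * M₂ + (b * c₂ + c * c₄) * N₂)
        ((b * c₁ + c * c₃) * P + (b * c₂ + c * c₄) * P')
        ((b * c₁ + c * c₃) * Q + (b * c₂ + c * c₄) * Q')
        ((b * c₁ + c * c₃) * R + (b * c₂ + c * c₄) * R') := by
    intro a b c
    have h1 : A * symMat a (b * m₁ + c * n₁) (b * m₂ + c * n₂) (b * p + c * p') (b * q + c * q')
        (b * r + c * r') * Aᵀ = symMat (l ^ 2 * a + φ b c)
        (b * (b₁ * (l * m₁ + p * u₁ + q * u₂) + b₂ * (l * m₂ + q * u₁ + r * u₂)) +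
          c * (b₁ * (l * n₁ + p' * u₁ + q' * u₂) + b₂ * (l * n₂ + q' * u₁ + r' * u₂)))
        (b * (b₃ * (l * m₁ + p * u₁ + q * u₂) + b₄ * (l * m₂ + q * u₁ + r * u₂)) +
          c * (b₃ * (l * n₁ + p' * u₁ + q' * u₂) + b₄ * (l * n₂ + q' * u₁ + r' * u₂)))
        (b * (b₁ ^ 2 * p + 2 * b₁ * b₂ * q + b₂ ^ 2 * r) +
          c * (b₁ ^ 2 * p' + 2 * b₁ * b₂ * q' + b₂ ^ 2 * r'))
        (b * (b₁ * b₃ * p + (b₁ * b₄ + b₂ * b₃) * q + b₂ * b₄ * r) +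
          c * (b₁ * b₃ * p' + (b₁ * b₄ + b₂ * b₃) * q' + b₂ * b₄ * r'))
        (b * (b₃ ^ 2 * p + 2 * b₃ * b₄ * q + b₄ ^ 2 * r) +
          c * (b₃ ^ 2 * p' + 2 * b₃ * b₄ * q' + b₄ ^ 2 * r')) := by
      ext i j
      fin_cases i <;> fin_cases j <;>
        simp [symMat, hA, φ, Matrix.mul_apply, Fin.sum_univ_three] <;> ring
    rw [h1, e₁, e₂, e₃, e₄, e₅, f₁, f₂, f₃, f₄, f₅, symMat_inj]
    refine ⟨rfl, ?_, ?_, ?_, ?_, ?_⟩ <;> ring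
  refine ⟨A, ?_, ?_⟩
  · rw [Matrix.isUnit_iff_isUnit_det, isUnit_iff_ne_zero]
    have : A.det = l * (b₁ * b₄ - b₂ * b₃) := by
      simp [hA, Matrix.det_fin_three]; ring
    rw [this]
    exact mul_ne_zero hl hb
  · ext M
    simp only [Set.mem_image, SetLike.mem_coe, mem_net]
    constructor
    · rintro ⟨a, b, c, rfl⟩
      refine ⟨_, ⟨(a - φ ((b * c₄ - c * c₃) / (c₁ * c₄ - c₂ * c₃))
        ((c * c₁ - b * c₂) / (c₁ * c₄ - c₂ * c₃))) / l ^ 2,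
        (b * c₄ - c * c₃) / (c₁ * c₄ - c₂ * c₃),
        (c * c₁ - b * c₂) / (c₁ * c₄ - c₂ * c₃), rfl⟩, ?_⟩
      rw [key]
      have hb' : (b * c₄ - c * c₃) / (c₁ * c₄ - c₂ * c₃) * c₁ +
          (c * c₁ - b * c₂) / (c₁ * c₄ - c₂ * c₃) * c₃ = b := by
        rw [div_mul_eq_mul_div, div_mul_eq_mul_div, ← add_div, div_eq_iff hc]; ring
      have hc' : (b * c₄ - c * c₃) / (c₁ * c₄ - c₂ * c₃) * c₂ +
          (c * c₁ - b * c₂) / (c₁ * c₄ - c₂ * c₃) * c₄ = c := by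
        rw [div_mul_eq_mul_div, div_mul_eq_mul_div, ← add_div, div_eq_iff hc]; ring
      rw [hb', hc', mul_div_cancel₀ _ (pow_ne_zero 2 hl), sub_add_cancel]
    · rintro ⟨_, ⟨a, b, c, rfl⟩, rfl⟩
      exact ⟨_, _, _, (key a b c).symm⟩

end Basic

section Reduction

variable {F : Type*} [Field F]

/-- Every nonzero binary quadratic form is, up to a scalar, hyperbolic, equal to the anisotropic
form `x ^ 2 - ν * y ^ 2`, or of rank one. -/
theorem exists_quadratic_normal_form {ν : F} (h2 : (2 : F) ≠ 0)
    (hν : ∀ d : F, d ≠ 0 → (∃ s, d = s ^ 2) ∨ ∃ s, d = ν * s ^ 2) (p q r : F)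
    (h : p ≠ 0 ∨ q ≠ 0 ∨ r ≠ 0) :
    ∃ b₁ b₂ b₃ b₄ c : F, b₁ * b₄ - b₂ * b₃ ≠ 0 ∧ c ≠ 0 ∧
      ((b₁ ^ 2 * p + 2 * b₁ * b₂ * q + b₂ ^ 2 * r = 0 ∧
        b₁ * b₃ * p + (b₁ * b₄ + b₂ * b₃) * q + b₂ * b₄ * r = c ∧
        b₃ ^ 2 * p + 2 * b₃ * b₄ * q + b₄ ^ 2 * r = 0) ∨
      (b₁ ^ 2 * p + 2 * b₁ * b₂ * q + b₂ ^ 2 * r = c ∧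
        b₁ * b₃ * p + (b₁ * b₄ + b₂ * b₃) * q + b₂ * b₄ * r = 0 ∧
        b₃ ^ 2 * p + 2 * b₃ * b₄ * q + b₄ ^ 2 * r = -ν * c) ∨
      (b₁ ^ 2 * p + 2 * b₁ * b₂ * q + b₂ ^ 2 * r = 0 ∧
        b₁ * b₃ * p + (b₁ * b₄ + b₂ * b₃) * q + b₂ * b₄ * r = 0 ∧
        b₃ ^ 2 * p + 2 * b₃ * b₄ * q + b₄ ^ 2 * r = c)) := by
  wlog hp : p ≠ 0 generalizing p r
  · push Not at hp
    subst hp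
    by_cases hr : r = 0
    · subst hr
      refine ⟨1, 0, 0, 1, q, by simp, by simpa using h, Or.inl ?_⟩
      simp
    · obtain ⟨b₁, b₂, b₃, b₄, c, hb, hc, hcases⟩ := this r 0 (Or.inl hr) hr
      refine ⟨b₂, b₁, b₄, b₃, c, fun h => hb (by linear_combination -h), hc, ?_⟩
      refine hcases.imp ?_ (Or.imp ?_ ?_)
      all_goals
        rintro ⟨h1, h2, h3⟩
        refine ⟨?_, ?_, ?_⟩
        · linear_combination h1
        · linear_combination h2
        · linear_combination h3
  by_cases he : p * r - q ^ 2 = 0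
  · refine ⟨-q, p, 1, 0, p, by simpa using hp, hp, Or.inr (Or.inr ⟨?_, ?_, ?_⟩)⟩
    · linear_combination p * he
    · ring
    · ring
  · rcases hν (-(p * r - q ^ 2)) (neg_ne_zero.2 he) with ⟨s, hs⟩ | ⟨s, hs⟩
    · have hs0 : s ≠ 0 := by
        rintro rfl
        exact he (by linear_combination -hs)
      refine ⟨s - q, p, s + q, -p, 2 * p * s ^ 2, ?_, ?_, Or.inl ⟨?_, ?_, ?_⟩⟩
      · have : (s - q) * -p - p * (s + q) = -(2 * s * p) := by ring
        rw [this]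
        simp [h2, hs0, hp]
      · simp [h2, hs0, hp]
      · linear_combination -p * hs
      · linear_combination p * hs
      · linear_combination -p * hs
    · have hs0 : s ≠ 0 := by
        rintro rfl
        exact he (by linear_combination -hs)
      refine ⟨1, 0, -q / s, p / s, p, ?_, hp, Or.inr (Or.inl ⟨?_, ?_, ?_⟩)⟩
      · simp [hs0, hp]
      · ring
      · field_simp; ring
      · field_simp
        linear_combination -hs

/-- The nets for which the lower right blocks form the pencil of diagonal matrices. -/
abbrev hypNet (s t : F) : Submodule F (Matrix (Fin 3) (Fin 3) F) := net 0 s 1 0 0 t 0 0 0 1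

/-- The nets for which the lower right blocks form a pencil without matrices of rank one;
the parameters `x`, `y` are the coordinates of `x + y √ν`. -/
abbrev ellNet (ν x y : F) : Submodule F (Matrix (Fin 3) (Fin 3) F) :=
  net (ν * y) x ν 0 1 (-x) (-y) 0 1 0

/-- The nets for which the lower right blocks form a pencil with one matrix of rank one. -/
abbrev parNet (s t : F) : Submodule F (Matrix (Fin 3) (Fin 3) F) := net 0 s 1 0 0 0 t 0 1 0

theorem exists_net_kEquiv_cross (m₁ m₂ p q r n₁ n₂ p' q' r' b₁ b₂ b₃ b₄ : F)
    (hb : b₁ * b₄ - b₂ * b₃ ≠ 0) (f₁ f₂ f₃ : F) (h₁ : f₁ = q * r' - r * q')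
    (h₂ : 2 * f₂ = r * p' - p * r') (h₃ : f₃ = p * q' - q * p') :
    ∃ M₁ M₂ P Q R N₁ N₂ P' Q' R' : F,
      KEquiv F (net m₁ m₂ p q r n₁ n₂ p' q' r') (net M₁ M₂ P Q R N₁ N₂ P' Q' R') ∧
      Q * R' - R * Q' =
        (b₁ * b₄ - b₂ * b₃) * (b₁ ^ 2 * f₁ + 2 * b₁ * b₂ * f₂ + b₂ ^ 2 * f₃) ∧
      R * P' - P * R' = 2 * (b₁ * b₄ - b₂ * b₃) *
        (b₁ * b₃ * f₁ + (b₁ * b₄ + b₂ * b₃) * f₂ + b₂ * b₄ * f₃) ∧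
      P * Q' - Q * P' =
        (b₁ * b₄ - b₂ * b₃) * (b₃ ^ 2 * f₁ + 2 * b₃ * b₄ * f₂ + b₄ ^ 2 * f₃) := by
  refine ⟨b₄ * m₁ - b₃ * m₂, b₁ * m₂ - b₂ * m₁,
    b₄ ^ 2 * p - 2 * b₃ * b₄ * q + b₃ ^ 2 * r,
    -b₂ * b₄ * p + (b₁ * b₄ + b₂ * b₃) * q - b₁ * b₃ * r,
    b₂ ^ 2 * p - 2 * b₁ * b₂ * q + b₁ ^ 2 * r,
    b₄ * n₁ - b₃ * n₂, b₁ * n₂ - b₂ * n₁,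
    b₄ ^ 2 * p' - 2 * b₃ * b₄ * q' + b₃ ^ 2 * r',
    -b₂ * b₄ * p' + (b₁ * b₄ + b₂ * b₃) * q' - b₁ * b₃ * r',
    b₂ ^ 2 * p' - 2 * b₁ * b₂ * q' + b₁ ^ 2 * r',
    net_kEquiv 1 0 0 b₄ (-b₃) (-b₂) b₁ 1 0 0 1 one_ne_zero ?_ (by simp)
    (by ring) (by ring) (by ring) (by ring) (by ring) (by ring) (by ring) (by ring) (by ring)
    (by ring), ?_, ?_, ?_⟩
  · intro h
    exact hb (by linear_combination h)
  · subst h₁ h₃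
    linear_combination -b₁ * b₂ * (b₁ * b₄ - b₂ * b₃) * h₂
  · subst h₁ h₃
    linear_combination -(b₁ * b₄ - b₂ * b₃) * (b₁ * b₄ + b₂ * b₃) * h₂
  · subst h₁ h₃
    linear_combination -(b₁ * b₄ - b₂ * b₃) * b₃ * b₄ * h₂

end Reduction

section Completeness

variable {F : Type*} [Field F]

theorem exists_net_kEquiv_blocks {m₁ m₂ p q r n₁ n₂ p' q' r' P Q R P' Q' R' : F}
    (c₁ c₂ c₃ c₄ : F) (hc : c₁ * c₄ - c₂ * c₃ ≠ 0)
    (e₃ : p = c₁ * P + c₂ * P') (e₄ : q = c₁ * Q + c₂ * Q') (e₅ : r = c₁ * R + c₂ * R')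
    (f₃ : p' = c₃ * P + c₄ * P') (f₄ : q' = c₃ * Q + c₄ * Q') (f₅ : r' = c₃ * R + c₄ * R') :
    ∃ M₁ M₂ N₁ N₂ : F,
      KEquiv F (net m₁ m₂ p q r n₁ n₂ p' q' r') (net M₁ M₂ P Q R N₁ N₂ P' Q' R') := by
  refine ⟨(c₄ * m₁ - c₂ * n₁) / (c₁ * c₄ - c₂ * c₃), (c₄ * m₂ - c₂ * n₂) / (c₁ * c₄ - c₂ * c₃),
    (c₁ * n₁ - c₃ * m₁) / (c₁ * c₄ - c₂ * c₃), (c₁ * n₂ - c₃ * m₂) / (c₁ * c₄ - c₂ * c₃),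
    net_kEquiv 1 0 0 1 0 0 1 c₁ c₂ c₃ c₄ one_ne_zero (by simp) hc ?_ ?_ (by rw [← e₃]; ring)
      (by rw [← e₄]; ring) (by rw [← e₅]; ring) ?_ ?_ (by rw [← f₃]; ring) (by rw [← f₄]; ring)
      (by rw [← f₅]; ring)⟩
  all_goals
    rw [mul_div_assoc', mul_div_assoc', ← add_div, eq_div_iff hc]
    ring

variable {C : Submodule F (Matrix (Fin 3) (Fin 3) F) → Prop}

theorem of_cross_ne_zero (hC : ∀ W W', KEquiv F W W' → C W' → C W) {ν : F} (h2 : (2 : F) ≠ 0)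
    (hν0 : ν ≠ 0) (hν : ∀ d : F, d ≠ 0 → (∃ s, d = s ^ 2) ∨ ∃ s, d = ν * s ^ 2)
    (hyp : ∀ s t, C (hypNet s t)) (ell : ∀ x y, C (ellNet ν x y)) (par : ∀ s t, C (parNet s t))
    (m₁ m₂ p q r n₁ n₂ p' q' r' : F)
    (h : q * r' - r * q' ≠ 0 ∨ r * p' - p * r' ≠ 0 ∨ p * q' - q * p' ≠ 0) :
    C (net m₁ m₂ p q r n₁ n₂ p' q' r') := by
  have hf2 : 2 * ((r * p' - p * r') / 2) = r * p' - p * r' := by field_simp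
  obtain ⟨b₁, b₂, b₃, b₄, c, hb, hc, hcases⟩ := exists_quadratic_normal_form h2 hν
    (q * r' - r * q') ((r * p' - p * r') / 2) (p * q' - q * p')
    (by simpa [h2] using h)
  obtain ⟨M₁, M₂, P, Q, R, N₁, N₂, P', Q', R', hk, k₁, k₂, k₃⟩ :=
    exists_net_kEquiv_cross m₁ m₂ p q r n₁ n₂ p' q' r' b₁ b₂ b₃ b₄ hb _ _ _ rfl hf2 rfl
  refine hC _ _ hk ?_
  have hbc := mul_ne_zero hb hc
  have hX : P * (Q * R' - R * Q') + Q * (R * P' - P * R') + R * (P * Q' - Q * P') = 0 := by ring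
  have hX' : P' * (Q * R' - R * Q') + Q' * (R * P' - P * R') + R' * (P * Q' - Q * P') = 0 := by
    ring
  rcases hcases with ⟨g₁, g₂, g₃⟩ | ⟨g₁, g₂, g₃⟩ | ⟨g₁, g₂, g₃⟩ <;> rw [g₁] at k₁ <;>
    rw [g₂] at k₂ <;> rw [g₃] at k₃
  · have hD : 2 * ((b₁ * b₄ - b₂ * b₃) * c) ≠ 0 := mul_ne_zero h2 hbc
    rw [k₁, k₂, k₃] at hX hX'
    have hQ : Q = 0 := by
      rw [← mul_right_inj' hD]; linear_combination hX
    have hQ' : Q' = 0 := by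
      rw [← mul_right_inj' hD]; linear_combination hX'
    obtain ⟨A₁, A₂, B₁, B₂, hk'⟩ := exists_net_kEquiv_blocks (m₁ := M₁) (m₂ := M₂) (p := P)
      (q := Q) (r := R) (n₁ := N₁) (n₂ := N₂) (p' := P') (q' := Q') (r' := R')
      (P := 1) (Q := 0) (R := 0) (P' := 0) (Q' := 0) (R' := 1) P R P' R'
      (fun h => hD (by linear_combination -h - k₂))
      (by ring) (by simp [hQ]) (by ring) (by ring) (by simp [hQ']) (by ring)
    refine hC _ _ hk' (hC _ _ ?_ (hyp A₂ B₁))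
    apply net_kEquiv 1 (-A₁) (-B₂) 1 0 0 1 1 0 0 1 <;> first | ring1 | simp
  · rw [k₁, k₂, k₃] at hX hX'
    have hP : P = ν * R := by
      rw [← mul_right_inj' hbc]; linear_combination hX
    have hP' : P' = ν * R' := by
      rw [← mul_right_inj' hbc]; linear_combination hX'
    obtain ⟨A₁, A₂, B₁, B₂, hk'⟩ := exists_net_kEquiv_blocks (m₁ := M₁) (m₂ := M₂) (p := P)
      (q := Q) (r := R) (n₁ := N₁) (n₂ := N₂) (p' := P') (q' := Q') (r' := R')
      (P := ν) (Q := 0) (R := 1) (P' := 0) (Q' := 1) (R' := 0) R Q R' Q'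
      (fun h => hbc (by linear_combination -h - k₁))
      (by rw [hP]; ring) (by ring) (by ring) (by rw [hP']; ring) (by ring) (by ring)
    refine hC _ _ hk' (hC _ _ ?_ (ell ((A₂ - B₁) / 2) ((A₁ / ν - B₂) / 2)))
    apply net_kEquiv 1 (-(A₁ / ν + B₂) / 2) (-(A₂ + B₁) / 2) 1 0 0 1 1 0 0 1
    all_goals first | ring1 | (simp; done) | (field_simp; ring1)
  · rw [k₁, k₂, k₃] at hX hX'
    have hR : R = 0 := by
      rw [← mul_right_inj' hbc]; linear_combination hX
    have hR' : R' = 0 := by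
      rw [← mul_right_inj' hbc]; linear_combination hX'
    obtain ⟨A₁, A₂, B₁, B₂, hk'⟩ := exists_net_kEquiv_blocks (m₁ := M₁) (m₂ := M₂) (p := P)
      (q := Q) (r := R) (n₁ := N₁) (n₂ := N₂) (p' := P') (q' := Q') (r' := R')
      (P := 1) (Q := 0) (R := 0) (P' := 0) (Q' := 1) (R' := 0) P Q P' Q'
      (fun h => hbc (by linear_combination h - k₃))
      (by ring) (by ring) (by simp [hR]) (by ring) (by ring) (by simp [hR'])
    refine hC _ _ hk' (hC _ _ ?_ (par A₂ (B₂ - A₁)))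
    apply net_kEquiv 1 (-A₁) (-B₁) 1 0 0 1 1 0 0 1 <;> first | ring1 | simp

theorem of_second_block_zero (hC : ∀ W W', KEquiv F W W' → C W' → C W) {ν : F}
    (h2 : (2 : F) ≠ 0) (hns : ∀ s : F, ν ≠ s ^ 2)
    (hν : ∀ d : F, d ≠ 0 → (∃ s, d = s ^ 2) ∨ ∃ s, d = ν * s ^ 2)
    (h₂ : C (net 0 0 0 1 0 1 0 0 0 0)) (h₃ : C (net 0 0 0 1 0 1 1 0 0 0))
    (h₄ : C (net 0 0 1 0 (-ν) 1 0 0 0 0)) (h₅ : C (net 0 0 1 0 0 0 1 0 0 0))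
    (h₆ : C (net 0 0 1 0 0 1 0 0 0 0)) (h₇ : C (net 0 1 1 0 0 1 0 0 0 0))
    (m₁ m₂ p q r n₁ n₂ : F) (hX : p ≠ 0 ∨ q ≠ 0 ∨ r ≠ 0) (hn : n₁ ≠ 0 ∨ n₂ ≠ 0) :
    C (net m₁ m₂ p q r n₁ n₂ 0 0 0) := by
  have hν0 : ν ≠ 0 := by simpa using hns 0
  obtain ⟨b₁, b₂, b₃, b₄, c, hb, hc, hcases⟩ := exists_quadratic_normal_form h2 hν p q r hX
  have step : ∀ P Q R : F, b₁ ^ 2 * p + 2 * b₁ * b₂ * q + b₂ ^ 2 * r = c * P →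
      b₁ * b₃ * p + (b₁ * b₄ + b₂ * b₃) * q + b₂ * b₄ * r = c * Q →
      b₃ ^ 2 * p + 2 * b₃ * b₄ * q + b₄ ^ 2 * r = c * R →
      (∀ M₁ M₂ N₁ N₂ : F, N₁ ≠ 0 ∨ N₂ ≠ 0 → C (net M₁ M₂ P Q R N₁ N₂ 0 0 0)) →
      C (net m₁ m₂ p q r n₁ n₂ 0 0 0) := by
    intro P Q R e₃ e₄ e₅ H
    refine hC _ _ ?_ (H ((b₁ * m₁ + b₂ * m₂) / c) ((b₃ * m₁ + b₄ * m₂) / c)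
      (b₁ * n₁ + b₂ * n₂) (b₃ * n₁ + b₄ * n₂) ?_)
    · apply net_kEquiv 1 0 0 b₁ b₂ b₃ b₄ c 0 0 1 one_ne_zero hb (by simpa using hc)
      · field_simp; ring
      · field_simp; ring
      · rw [e₃]; ring
      · rw [e₄]; ring
      · rw [e₅]; ring
      all_goals ring
    · by_contra! h
      have e₁ : (b₁ * b₄ - b₂ * b₃) * n₁ = 0 := by
        linear_combination b₄ * h.1 - b₂ * h.2
      have e₂ : (b₁ * b₄ - b₂ * b₃) * n₂ = 0 := by
        linear_combination b₁ * h.2 - b₃ * h.1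
      simp [hb] at e₁ e₂
      simp [e₁, e₂] at hn
  rcases hcases with ⟨g₁, g₂, g₃⟩ | ⟨g₁, g₂, g₃⟩ | ⟨g₁, g₂, g₃⟩
  · refine step 0 1 0 (by simpa using g₁) (by simpa using g₂) (by simpa using g₃) ?_
    intro M₁ M₂ N₁ N₂ hN
    by_cases hN₂ : N₂ = 0
    · have hN₁ : N₁ ≠ 0 := by simpa [hN₂] using hN
      refine hC _ _ ?_ h₂
      apply net_kEquiv 1 (-M₂) (-M₁) 1 0 0 1 1 0 0 N₁ <;> first | ring1 | simp [hN₁, hN₂]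
    · by_cases hN₁ : N₁ = 0
      · refine hC _ _ ?_ h₂
        apply net_kEquiv 1 (-M₂) (-M₁) 0 1 1 0 1 0 0 N₂ <;> first | ring1 | simp [hN₁, hN₂]
      · refine hC _ _ ?_ h₃
        apply net_kEquiv 1 (-M₂) (-M₁) N₂ 0 0 N₁ (N₁ * N₂) 0 0 (N₁ * N₂) <;>
          first | ring1 | simp [hN₁, hN₂]
  · refine step 1 0 (-ν) (by simpa using g₁) (by simpa using g₂) (by rw [g₃]; ring) ?_
    intro M₁ M₂ N₁ N₂ hN
    have hD : ν * N₁ ^ 2 - N₂ ^ 2 ≠ 0 := by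
      intro h
      by_cases hN₁ : N₁ = 0
      · simp_all
      · exact hns (N₂ / N₁) (by field_simp; linear_combination h)
    refine hC _ _ ?_ h₄
    apply net_kEquiv 1 (-M₁) (M₂ / ν) (ν * N₁) (-N₂) (-ν * N₂) (ν * N₁)
      (ν * (ν * N₁ ^ 2 - N₂ ^ 2)) 0 0 (ν * N₁ ^ 2 - N₂ ^ 2)
    · simp
    · intro h
      exact mul_ne_zero hν0 hD (by linear_combination h)
    · simpa [hν0] using hD
    all_goals first | ring1 | (simp; done) | (field_simp; ring1)
  · refine step 0 0 1 (by simpa using g₁) (by simpa using g₂) (by simpa using g₃) ?_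
    intro M₁ M₂ N₁ N₂ hN
    by_cases hN₁ : N₁ = 0
    · have hN₂ : N₂ ≠ 0 := by simpa [hN₁] using hN
      by_cases hM₁ : M₁ = 0
      · refine hC _ _ ?_ h₆
        apply net_kEquiv 1 0 (-M₂) 0 1 1 0 1 0 0 N₂ <;> first | ring1 | simp [hN₁, hN₂, hM₁]
      · refine hC _ _ ?_ h₇
        apply net_kEquiv 1 0 (-M₂) 0 1 (1 / M₁) 0 1 0 0 N₂ <;>
          first | ring1 | simp [hN₁, hN₂, hM₁]
    · refine hC _ _ ?_ h₅
      apply net_kEquiv 1 0 (N₂ / N₁ * M₁ - M₂) (-N₂ / N₁) 1 1 0 1 M₁ 0 N₁ <;>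
        first | ring1 | simp [hN₁]

theorem of_net (hC : ∀ W W', KEquiv F W W' → C W' → C W) {ν : F}
    (h2 : (2 : F) ≠ 0) (hns : ∀ s : F, ν ≠ s ^ 2)
    (hν : ∀ d : F, d ≠ 0 → (∃ s, d = s ^ 2) ∨ ∃ s, d = ν * s ^ 2)
    (h₁ : C (net 1 0 0 0 0 0 1 0 0 0))
    (h₂ : C (net 0 0 0 1 0 1 0 0 0 0)) (h₃ : C (net 0 0 0 1 0 1 1 0 0 0))
    (h₄ : C (net 0 0 1 0 (-ν) 1 0 0 0 0)) (h₅ : C (net 0 0 1 0 0 0 1 0 0 0))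
    (h₆ : C (net 0 0 1 0 0 1 0 0 0 0)) (h₇ : C (net 0 1 1 0 0 1 0 0 0 0))
    (hyp : ∀ s t, C (hypNet s t)) (ell : ∀ x y, C (ellNet ν x y)) (par : ∀ s t, C (parNet s t))
    (m₁ m₂ p q r n₁ n₂ p' q' r' : F)
    (hind : ∀ x y : F, x * m₁ + y * n₁ = 0 → x * m₂ + y * n₂ = 0 → x * p + y * p' = 0 →
      x * q + y * q' = 0 → x * r + y * r' = 0 → x = 0 ∧ y = 0) :
    C (net m₁ m₂ p q r n₁ n₂ p' q' r') := by
  have hν0 : ν ≠ 0 := by simpa using hns 0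
  by_cases hcr : q * r' - r * q' ≠ 0 ∨ r * p' - p * r' ≠ 0 ∨ p * q' - q * p' ≠ 0
  · exact of_cross_ne_zero hC h2 hν0 hν hyp ell par _ _ _ _ _ _ _ _ _ _ hcr
  push Not at hcr
  obtain ⟨k₁, k₂, k₃⟩ := hcr
  wlog hX : p ≠ 0 ∨ q ≠ 0 ∨ r ≠ 0 generalizing m₁ m₂ p q r n₁ n₂ p' q' r'
  · by_cases hX' : p' ≠ 0 ∨ q' ≠ 0 ∨ r' ≠ 0
    · refine hC _ _ ?_ (this n₁ n₂ p' q' r' m₁ m₂ p q r ?_ (by linear_combination -k₁)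
        (by linear_combination -k₂) (by linear_combination -k₃) hX')
      · apply net_kEquiv 1 0 0 1 0 0 1 0 1 1 0 <;> first | ring1 | simp
      · intro x y e₁ e₂ e₃ e₄ e₅
        exact (hind y x (by linear_combination e₁) (by linear_combination e₂)
          (by linear_combination e₃) (by linear_combination e₄) (by linear_combination e₅)).symm
    · push Not at hX hX'
      obtain ⟨rfl, rfl, rfl⟩ := hX
      obtain ⟨rfl, rfl, rfl⟩ := hX'
      have hD : m₁ * n₂ - m₂ * n₁ ≠ 0 := by
        intro hD
        have a₁ := hind n₂ (-m₂) (by linear_combination hD) (by ring) (by ring) (by ring) (by ring)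
        have a₂ := hind n₁ (-m₁) (by ring) (by linear_combination -hD) (by ring) (by ring)
          (by ring)
        have a₃ : m₂ = 0 := by simpa using a₁.2
        have a₄ : m₁ = 0 := by simpa using a₂.2
        exact one_ne_zero (hind 1 0 (by rw [a₄]; ring) (by rw [a₃]; ring) (by ring) (by ring)
          (by ring)).1
      refine hC _ _ ?_ h₁
      apply net_kEquiv 1 0 0 1 0 0 1 m₁ m₂ n₁ n₂ one_ne_zero (by simp) hD <;> ring
  · obtain ⟨k, rfl, rfl, rfl⟩ : ∃ k, p' = k * p ∧ q' = k * q ∧ r' = k * r := by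
      rcases hX with h | h | h
      · exact ⟨p' / p, by field_simp, by field_simp; linear_combination k₃,
          by field_simp; linear_combination -k₂⟩
      · exact ⟨q' / q, by field_simp; linear_combination -k₃, by field_simp,
          by field_simp; linear_combination k₁⟩
      · exact ⟨r' / r, by field_simp; linear_combination k₂,
          by field_simp; linear_combination -k₁, by field_simp⟩
    refine hC _ _ ?_ (of_second_block_zero hC h2 hns hν h₂ h₃ h₄ h₅ h₆ h₇ m₁ m₂ p q r
      (n₁ - k * m₁) (n₂ - k * m₂) hX ?_)
    · apply net_kEquiv 1 0 0 1 0 0 1 1 0 k 1 <;> first | ring1 | simp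
    · by_contra! h
      have := hind (-k) 1 (by linear_combination h.1) (by linear_combination h.2) (by ring)
        (by ring) (by ring)
      simp at this

end Completeness

section Families

variable {F : Type*} [Field F]

theorem hypNet_kEquiv {s t s' t' : F} (l x z : F) (hl : l ≠ 0) (hx : x ≠ 0) (hz : z ≠ 0)
    (hs : l * z * s = x ^ 2 * s') (ht : l * x * t = z ^ 2 * t') :
    KEquiv F (hypNet s t) (hypNet s' t') := by
  apply net_kEquiv l 0 0 x 0 0 z (x ^ 2) 0 0 (z ^ 2) hl (by simp [hx, hz]) (by simp [hx, hz])
  · ring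
  · linear_combination hs
  all_goals first | ring1 | linear_combination ht

theorem hypNet_kEquiv_swap (s t : F) : KEquiv F (hypNet s t) (hypNet t s) := by
  apply net_kEquiv 1 0 0 0 1 1 0 0 1 1 0 <;> first | ring1 | simp

theorem ellNet_kEquiv {ν x y x' y' : F} (hν : ∀ s : F, ν ≠ s ^ 2)
    (m k₀ k₁ : F) (hm : m ≠ 0) (hk : k₀ ≠ 0 ∨ k₁ ≠ 0)
    (hx : m * ((k₀ ^ 3 + 3 * ν * k₀ * k₁ ^ 2) * x + ν * (3 * k₀ ^ 2 * k₁ + ν * k₁ ^ 3) * y) = x')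
    (hy : m * ((k₀ ^ 3 + 3 * ν * k₀ * k₁ ^ 2) * y + (3 * k₀ ^ 2 * k₁ + ν * k₁ ^ 3) * x) = y') :
    KEquiv F (ellNet ν x y) (ellNet ν x' y') := by
  have hN : k₀ ^ 2 - ν * k₁ ^ 2 ≠ 0 := by
    intro h
    by_cases h1 : k₁ = 0
    · simp_all
    · exact hν (k₀ / k₁) (by field_simp; linear_combination -h)
  subst hx hy
  apply net_kEquiv ((k₀ ^ 2 - ν * k₁ ^ 2) ^ 2 * m) 0 0 k₀ (ν * k₁) k₁ k₀ (k₀ ^ 2 + ν * k₁ ^ 2)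
    (2 * ν * k₀ * k₁) (2 * k₀ * k₁) (k₀ ^ 2 + ν * k₁ ^ 2)
  · simp [hN, hm]
  · intro h; exact hN (by linear_combination h)
  · intro h
    exact pow_ne_zero 2 hN (by linear_combination h)
  all_goals ring1

theorem ellNet_kEquiv_conj (ν x y : F) : KEquiv F (ellNet ν x y) (ellNet ν x (-y)) := by
  apply net_kEquiv 1 0 0 (-1) 0 0 1 1 0 0 (-1) <;> first | ring1 | simp

theorem parNet_kEquiv {s t s' t' : F} (l x y z : F) (hl : l ≠ 0) (hx : x ≠ 0) (hz : z ≠ 0)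
    (hs : s' = l * z * s / x ^ 2) (ht : t' = l * (t / x - 3 * y * s / x ^ 2)) :
    KEquiv F (parNet s t) (parNet s' t') := by
  subst hs ht
  apply net_kEquiv l (-l * s * y / x) (-y * (l * t - l * s * y / x) / x) x y 0 z (x ^ 2) 0
    (2 * x * y) (x * z) hl (by simp [hx, hz]) (by simp [hx, hz])
  all_goals first | ring1 | (field_simp; ring1)

end Families

section Cubes

theorem exists_pow_three_eq {G : Type*} [Group G] (h : (Nat.card G).Coprime 3) (x : G) :
    ∃ y, y ^ 3 = x := by
  exact ⟨(powCoprime h).symm x, (powCoprime h).apply_symm_apply x⟩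

theorem exists_pow_three_ne {G : Type*} [CommGroup G] [Finite G] (h : 3 ∣ Nat.card G) :
    ∃ x : G, ∀ y, y ^ 3 ≠ x := by
  by_contra! hc
  have hinj : Function.Injective (fun y : G => y ^ 3) := Finite.injective_iff_surjective.2 hc
  have : Fact (Nat.Prime 3) := ⟨Nat.prime_three⟩
  obtain ⟨x, hx⟩ := exists_prime_orderOf_dvd_card' 3 h
  have h1 : x ^ 3 = 1 := by rw [← hx]; exact pow_orderOf_eq_one x
  have : x = 1 := hinj (by simpa using h1)
  rw [this, orderOf_one] at hx
  omega

theorem exists_generator_mod_cubes (G : Type*) [CommGroup G] [IsCyclic G] :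
    ∃ g : G, ∀ x, ∃ y, x = y ^ 3 ∨ x = g * y ^ 3 ∨ x = g⁻¹ * y ^ 3 := by
  obtain ⟨g, hg⟩ := IsCyclic.exists_generator (α := G)
  refine ⟨g, fun x => ?_⟩
  obtain ⟨n, rfl⟩ := Subgroup.mem_zpowers_iff.1 (hg x)
  have h : n % 3 = 0 ∨ n % 3 = 1 ∨ n % 3 = 2 := by omega
  rcases h with h | h | h
  · refine ⟨g ^ (n / 3), Or.inl ?_⟩
    rw [← zpow_natCast, ← _root_.zpow_mul]
    congr 1; push_cast; omega
  · refine ⟨g ^ (n / 3), Or.inr (Or.inl ?_)⟩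
    rw [← zpow_natCast, ← _root_.zpow_mul, ← _root_.zpow_one_add]
    congr 1; push_cast; omega
  · refine ⟨g ^ (n / 3 + 1), Or.inr (Or.inr ?_)⟩
    rw [← zpow_natCast, ← _root_.zpow_mul, ← _root_.zpow_neg_one, ← _root_.zpow_add]
    congr 1; push_cast; omega

theorem exists_generator_mod_cubes_field (K : Type*) [Field K] [Finite K] :
    ∃ g : K, g ≠ 0 ∧ ∀ x : K, x ≠ 0 → ∃ y, y ≠ 0 ∧
      (x = y ^ 3 ∨ x = g * y ^ 3 ∨ x = g⁻¹ * y ^ 3) := by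
  obtain ⟨g, hg⟩ := exists_generator_mod_cubes Kˣ
  refine ⟨g, g.ne_zero, fun x hx => ?_⟩
  obtain ⟨y, hy⟩ := hg (Units.mk0 x hx)
  refine ⟨y, y.ne_zero, hy.imp ?_ (Or.imp ?_ ?_)⟩ <;> intro h <;>
    simpa using congrArg Units.val h

variable {F K : Type*} [Field F] [Fintype F] [Field K] [Finite K] [Algebra F K]

theorem exists_pow_three_of_three_eq_zero {K : Type*} [Field K] [Finite K] (h : (3 : K) = 0)
    (x : K) : ∃ y, x = y ^ 3 := by
  have hinj : Function.Injective (fun y : K => y ^ 3) := by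
    intro a b hab
    have h1 : (a - b) ^ 3 = 0 := by
      have : a ^ 3 = b ^ 3 := hab
      linear_combination this + (-a ^ 2 * b + a * b ^ 2) * h
    exact sub_eq_zero.1 (pow_eq_zero_iff (by norm_num) |>.1 h1)
  obtain ⟨y, hy⟩ := Finite.surjective_of_injective hinj x
  exact ⟨y, hy.symm⟩

/-- In a quadratic extension `K / F` of finite fields of characteristic different from three,
either `F` or `K ⧸ F` has elements that are not cubes, but not both. -/
theorem cubes_dichotomy (hK : Module.finrank F K = 2) (h3 : (3 : F) ≠ 0) :
    ((∃ g : F, g ≠ 0 ∧ ∀ y, g ≠ y ^ 3) ∧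
      ∀ τ : K, τ ≠ 0 → ∃ (m : F) (κ : K), m ≠ 0 ∧ κ ≠ 0 ∧ τ = m • κ ^ 3) ∨
    ((∀ x : F, ∃ y, x = y ^ 3) ∧
      ∃ γ : K, γ ≠ 0 ∧ ∀ (m : F) (κ : K), m ≠ 0 → γ ≠ m • κ ^ 3) := by
  have hcF : Nat.card Fˣ + 1 = Nat.card F := by
    rw [Nat.card_units]; have := Nat.card_pos (α := F); omega
  have hcK : Nat.card Kˣ + 1 = Nat.card F ^ 2 := by
    rw [Nat.card_units, ← hK, ← Module.natCard_eq_pow_finrank]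
    have := Nat.card_pos (α := K); omega
  have hq : Nat.card F % 3 ≠ 0 := by
    intro h
    have : Fact (Nat.Prime 3) := ⟨Nat.prime_three⟩
    obtain ⟨x, hx⟩ := exists_prime_addOrderOf_dvd_card' (G := F) 3 (Nat.dvd_of_mod_eq_zero h)
    have h1 : (3 : F) * x = 0 := by
      have := addOrderOf_nsmul_eq_zero x
      rw [hx] at this
      simpa using this
    have h0 : x = 0 := by simpa [h3] using h1
    rw [h0, addOrderOf_zero] at hx
    omega
  have hmul : Nat.card Kˣ = Nat.card Fˣ * (Nat.card Fˣ + 2) := by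
    rw [← hcF] at hcK
    have : (Nat.card Fˣ + 1) ^ 2 = Nat.card Fˣ * (Nat.card Fˣ + 2) + 1 := by ring
    omega
  have hcases : Nat.card Fˣ % 3 = 0 ∨ Nat.card Fˣ % 3 = 1 := by omega
  rcases hcases with h | h
  · left
    constructor
    · obtain ⟨x, hx⟩ := exists_pow_three_ne (G := Fˣ) (Nat.dvd_of_mod_eq_zero h)
      refine ⟨x, x.ne_zero, fun y hy => ?_⟩
      have hy0 : y ≠ 0 := by
        rintro rfl
        simp at hy
      exact hx (Units.mk0 y hy0) (Units.ext (by simpa using hy.symm))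
    · let f : Fˣ →* Kˣ := Units.map (algebraMap F K).toMonoidHom
      have hf : Function.Injective f :=
        Units.map_injective (algebraMap F K).injective
      have hr : Nat.card f.range = Nat.card Fˣ :=
        Nat.card_congr (Equiv.ofInjective f hf).symm
      have hquot : Nat.card (Kˣ ⧸ f.range) = Nat.card Fˣ + 2 := by
        have := Subgroup.card_eq_card_quotient_mul_card_subgroup f.range
        rw [hr, hmul, mul_comm] at this
        exact (Nat.eq_of_mul_eq_mul_right Nat.card_pos this).symm
      intro τ hτ
      obtain ⟨y, hy⟩ := exists_pow_three_eq (G := Kˣ ⧸ f.range)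
        (by rw [hquot, Nat.coprime_comm, Nat.Prime.coprime_iff_not_dvd Nat.prime_three]; omega)
        (QuotientGroup.mk (Units.mk0 τ hτ))
      obtain ⟨κ, rfl⟩ := QuotientGroup.mk_surjective y
      rw [← QuotientGroup.mk_pow, QuotientGroup.eq] at hy
      obtain ⟨m, hm⟩ := hy
      refine ⟨m, κ, m.ne_zero, κ.ne_zero, ?_⟩
      have := congrArg Units.val hm
      simp [f] at this
      rw [Algebra.smul_def, this]
      have := κ.ne_zero
      field_simp
  · right
    have hcube : ∀ x : F, ∃ y, x = y ^ 3 := by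
      intro x
      by_cases hx : x = 0
      · exact ⟨0, by simp [hx]⟩
      · obtain ⟨y, hy⟩ := exists_pow_three_eq (G := Fˣ)
          (by rw [Nat.coprime_comm, Nat.Prime.coprime_iff_not_dvd Nat.prime_three]; omega)
          (Units.mk0 x hx)
        exact ⟨y, by simpa using (congrArg Units.val hy).symm⟩
    refine ⟨hcube, ?_⟩
    obtain ⟨γ, hγ⟩ := exists_pow_three_ne (G := Kˣ)
      (by rw [hmul]; exact dvd_mul_of_dvd_right (by omega) _)
    refine ⟨γ, γ.ne_zero, fun m κ hm h => ?_⟩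
    obtain ⟨y, rfl⟩ := hcube m
    rw [Algebra.smul_def, map_pow, ← mul_pow] at h
    have h0 : algebraMap F K y * κ ≠ 0 := by
      intro h0
      rw [h0] at h
      simp at h
    exact hγ (Units.mk0 _ h0) (Units.ext (by simpa using h.symm))

end Cubes

section Representatives

variable {F : Type*} [Field F]

theorem ellNet_kEquiv_smul {ν : F} (hν : ∀ s : F, ν ≠ s ^ 2) (m : F) (hm : m ≠ 0)
    (κ τ : QuadraticAlgebra F ν 0) (hκ : κ ≠ 0) :
    KEquiv F (ellNet ν τ.re τ.im) (ellNet ν (m • (κ ^ 3 * τ)).re (m • (κ ^ 3 * τ)).im) := by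
  apply ellNet_kEquiv hν m κ.re κ.im hm
  · by_contra! h
    exact hκ (QuadraticAlgebra.ext h.1 h.2)
  · simp [pow_succ, hm]; ring
  · simp [pow_succ, hm]; ring

variable {C : Submodule F (Matrix (Fin 3) (Fin 3) F) → Prop}

theorem of_hypNet (hC : ∀ W W', KEquiv F W W' → C W' → C W) (h₀ : C (hypNet 0 0))
    (h₁ : C (hypNet 1 0)) (hc : ∀ c : F, c ≠ 0 → C (hypNet 1 c)) (s t : F) :
    C (hypNet s t) := by
  have key : ∀ s : F, s ≠ 0 → C (hypNet s 0) := fun s hs => hC _ _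
    (hypNet_kEquiv (1 / s) 1 1 (by simpa using hs) one_ne_zero one_ne_zero (by field_simp)
      (by ring)) h₁
  by_cases hs : s = 0
  · by_cases ht : t = 0
    · rw [hs, ht]; exact h₀
    · rw [hs]
      exact hC _ _ (hypNet_kEquiv_swap _ _) (key t ht)
  · by_cases ht : t = 0
    · rw [ht]; exact key s hs
    · exact hC _ _ (hypNet_kEquiv (1 / s) 1 1 (by simpa using hs) one_ne_zero one_ne_zero
        (by field_simp) (by ring)) (hc (t / s) (div_ne_zero ht hs))

theorem of_hypNet_one (hC : ∀ W W', KEquiv F W W' → C W' → C W) (g : F) (hg : g ≠ 0)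
    (hgen : ∀ x : F, x ≠ 0 → ∃ y, y ≠ 0 ∧ (x = y ^ 3 ∨ x = g * y ^ 3 ∨ x = g⁻¹ * y ^ 3))
    (h₁ : C (hypNet 1 1)) (h₂ : C (hypNet 1 g)) (c : F) (hc : c ≠ 0) : C (hypNet 1 c) := by
  have key : ∀ y c : F, y ≠ 0 → C (hypNet 1 c) → C (hypNet 1 (c * y ^ 3)) := by
    intro y c hy h
    refine hC _ _ (kEquiv_symm (hypNet_kEquiv (y ^ 2) y 1 (pow_ne_zero 2 hy) hy one_ne_zero
      (by ring) (by ring))) h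
  obtain ⟨y, hy, rfl | rfl | rfl⟩ := hgen c hc
  · simpa using key y 1 hy h₁
  · exact key y g hy h₂
  · refine key y _ hy (hC _ _ (hypNet_kEquiv_swap _ _) (hC _ _ (hypNet_kEquiv g 1 1 hg
      one_ne_zero one_ne_zero ?_ ?_) h₂))
    · field_simp
    · ring

theorem of_parNet (hC : ∀ W W', KEquiv F W W' → C W' → C W) (h₀ : C (parNet 0 0))
    (h₁ : C (parNet 0 1)) (h₂ : C (parNet 1 0)) (h₃ : (3 : F) = 0 → C (parNet 1 1)) (s t : F) :
    C (parNet s t) := by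
  by_cases hs : s = 0
  · by_cases ht : t = 0
    · rw [hs, ht]; exact h₀
    · exact hC _ _ (parNet_kEquiv (1 / t) 1 0 1 (by simpa using ht) one_ne_zero one_ne_zero
        (by simp [hs]) (by field_simp; simp)) h₁
  · by_cases h : (3 : F) = 0
    · by_cases ht : t = 0
      · exact hC _ _ (parNet_kEquiv (1 / s) 1 0 1 (by simpa using hs) one_ne_zero one_ne_zero
          (by field_simp) (by simp [ht])) h₂
      · exact hC _ _ (parNet_kEquiv (1 / t) 1 0 (t / s) (by simpa using ht) one_ne_zero
          (div_ne_zero ht hs) (by field_simp) (by field_simp; simp)) (h₃ h)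
    · exact hC _ _ (parNet_kEquiv (1 / s) 1 (t / (3 * s)) 1 (by simpa using hs) one_ne_zero
        one_ne_zero (by field_simp) (by field_simp; simp)) h₂

theorem of_ellNet (hC : ∀ W W', KEquiv F W W' → C W' → C W) {ν : F} (hν : ∀ s : F, ν ≠ s ^ 2)
    (γ : QuadraticAlgebra F ν 0)
    (hgen : ∀ τ : QuadraticAlgebra F ν 0, τ ≠ 0 → ∃ (m : F) (κ : QuadraticAlgebra F ν 0),
      m ≠ 0 ∧ κ ≠ 0 ∧ (τ = m • κ ^ 3 ∨ τ = m • (κ ^ 3 * γ) ∨ τ = m • (κ ^ 3 * star γ)))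
    (h₀ : C (ellNet ν 0 0)) (h₁ : C (ellNet ν 1 0)) (h₂ : C (ellNet ν γ.re γ.im)) (x y : F) :
    C (ellNet ν x y) := by
  by_cases h : (⟨x, y⟩ : QuadraticAlgebra F ν 0) = 0
  · have hx := congrArg QuadraticAlgebra.re h
    have hy := congrArg QuadraticAlgebra.im h
    simp at hx hy
    rw [hx, hy]; exact h₀
  · obtain ⟨m, κ, hm, hκ, hτ⟩ := hgen _ h
    have key : ∀ τ, C (ellNet ν τ.re τ.im) → (⟨x, y⟩ : QuadraticAlgebra F ν 0) = m • (κ ^ 3 * τ) →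
        C (ellNet ν x y) := by
      intro τ hτ h
      have := ellNet_kEquiv_smul hν m hm κ τ hκ
      rw [← h] at this
      exact hC _ _ (kEquiv_symm this) hτ
    rcases hτ with h | h | h
    · refine key 1 ?_ (by rw [h, mul_one])
      simpa [QuadraticAlgebra.re_one, QuadraticAlgebra.im_one] using h₁
    · exact key γ h₂ h
    · refine key (star γ) ?_ h
      refine hC _ _ (ellNet_kEquiv_conj ν _ _) ?_
      simpa using h₂

/-- The fifteen representatives; the last one depends on `q` modulo three. -/
def reps (ν : F) (X : Submodule F (Matrix (Fin 3) (Fin 3) F)) :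
    Fin 15 → Submodule F (Matrix (Fin 3) (Fin 3) F) :=
  ![net 1 0 0 0 0 0 1 0 0 0, net 0 0 0 1 0 1 0 0 0 0, net 0 0 0 1 0 1 1 0 0 0,
    net 0 0 1 0 (-ν) 1 0 0 0 0, net 0 0 1 0 0 0 1 0 0 0, net 0 0 1 0 0 1 0 0 0 0,
    net 0 1 1 0 0 1 0 0 0 0, hypNet 0 0, hypNet 1 0, ellNet ν 0 0, parNet 0 1, parNet 1 0,
    hypNet 1 1, ellNet ν 1 0, X]

/-- The possibilities for the fifteenth representative. -/
inductive IsExceptional (ν : F) : Submodule F (Matrix (Fin 3) (Fin 3) F) → Prop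
  | par (h3 : (3 : F) = 0) : IsExceptional ν (parNet 1 1)
  | hyp (g : F) (hg : g ≠ 0) (h : ∀ y, g ≠ y ^ 3) : IsExceptional ν (hypNet 1 g)
  | ell (γ : QuadraticAlgebra F ν 0) (hγ : γ ≠ 0) (h : ∀ (m : F) κ, m ≠ 0 → γ ≠ m • κ ^ 3) :
      IsExceptional ν (ellNet ν γ.re γ.im)

theorem parNet_zero_kEquiv : KEquiv F (parNet 0 0) (net 0 0 1 0 0 0 1 0 0 0) := by
  let A : Matrix (Fin 3) (Fin 3) F := !![0, 1, 0; 1, 0, 0; 0, 0, 1]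
  have key : ∀ a b c d e f : F, A * symMat a b c d e f * Aᵀ = symMat d b e a c f := by
    intro a b c d e f
    ext i j
    fin_cases i <;> fin_cases j <;>
      simp [symMat, A, Matrix.mul_apply, Fin.sum_univ_three]
  refine ⟨A, ?_, ?_⟩
  · rw [Matrix.isUnit_iff_isUnit_det]
    simp [A, Matrix.det_fin_three]
  · ext M
    simp only [Set.mem_image, SetLike.mem_coe, mem_net]
    constructor
    · rintro ⟨a, b, c, rfl⟩
      refine ⟨_, ⟨b, a, c, rfl⟩, ?_⟩
      rw [key, symMat_inj]
      simp
    · rintro ⟨_, ⟨a, b, c, rfl⟩, rfl⟩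
      refine ⟨b, a, c, ?_⟩
      rw [key, symMat_inj]
      simp

theorem exists_isExceptional [Fintype F] {ν : F} (h2 : (2 : F) ≠ 0) (hns : ∀ s : F, ν ≠ s ^ 2)
    (hν : ∀ d : F, d ≠ 0 → (∃ s, d = s ^ 2) ∨ ∃ s, d = ν * s ^ 2) :
    ∃ X, IsExceptional ν X ∧ ∀ m₁ m₂ p q r n₁ n₂ p' q' r' : F,
      (∀ x y : F, x * m₁ + y * n₁ = 0 → x * m₂ + y * n₂ = 0 → x * p + y * p' = 0 →
        x * q + y * q' = 0 → x * r + y * r' = 0 → x = 0 ∧ y = 0) →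
      ∃ i, KEquiv F (net m₁ m₂ p q r n₁ n₂ p' q' r') (reps ν X i) := by
  have : Fact (∀ r : F, r ^ 2 ≠ ν + 0 * r) := ⟨fun r h => hns r (by simpa using h.symm)⟩
  have : Finite (QuadraticAlgebra F ν 0) := Finite.of_equiv _ (QuadraticAlgebra.equivProd ν 0).symm
  suffices h : ∃ X, IsExceptional ν X ∧
      ∀ C : Submodule F (Matrix (Fin 3) (Fin 3) F) → Prop, (∀ W W', KEquiv F W W' → C W' → C W) →
        (∀ i, C (reps ν X i)) →
        (∀ s t, C (hypNet s t)) ∧ (∀ x y, C (ellNet ν x y)) ∧ (∀ s t, C (parNet s t)) by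
    obtain ⟨X, hX, h⟩ := h
    refine ⟨X, hX, fun m₁ m₂ p q r n₁ n₂ p' q' r' hind => ?_⟩
    let C : Submodule F (Matrix (Fin 3) (Fin 3) F) → Prop := fun W => ∃ i, KEquiv F W (reps ν X i)
    have hC : ∀ W W', KEquiv F W W' → C W' → C W := fun W W' h ⟨i, hi⟩ => ⟨i, kEquiv_trans h hi⟩
    have hR : ∀ i, C (reps ν X i) := fun i => ⟨i, kEquiv_refl _⟩
    obtain ⟨hyp, ell, par⟩ := h C hC hR
    exact of_net hC h2 hns hν (hR 0) (hR 1) (hR 2) (hR 3) (hR 4) (hR 5) (hR 6) hyp ell par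
      _ _ _ _ _ _ _ _ _ _ hind
  have hyp : ∀ C : Submodule F (Matrix (Fin 3) (Fin 3) F) → Prop,
      (∀ W W', KEquiv F W W' → C W' → C W) → (∀ x : F, ∃ y, x = y ^ 3) → ∀ X,
      (∀ i, C (reps ν X i)) → ∀ s t, C (hypNet s t) := by
    intro C hC hF X hR
    refine of_hypNet hC (hR 7) (hR 8) (of_hypNet_one hC 1 one_ne_zero ?_ (hR 12) (hR 12))
    intro x hx
    obtain ⟨y, rfl⟩ := hF x
    exact ⟨y, by rintro rfl; simp at hx, Or.inl rfl⟩
  have ell : ∀ C : Submodule F (Matrix (Fin 3) (Fin 3) F) → Prop,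
      (∀ W W', KEquiv F W W' → C W' → C W) → (∀ τ : QuadraticAlgebra F ν 0, τ ≠ 0 →
        ∃ (m : F) (κ : QuadraticAlgebra F ν 0), m ≠ 0 ∧ κ ≠ 0 ∧ τ = m • κ ^ 3) → ∀ X,
      (∀ i, C (reps ν X i)) → ∀ x y, C (ellNet ν x y) := by
    intro C hC hK X hR
    have h13 : C (ellNet ν 1 0) := hR 13
    refine of_ellNet hC hns 1 ?_ (hR 9) h13 (by
      simpa [QuadraticAlgebra.re_one, QuadraticAlgebra.im_one] using h13)
    intro τ hτ
    obtain ⟨m, κ, hm, hκ, h⟩ := hK τ hτ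
    exact ⟨m, κ, hm, hκ, Or.inl h⟩
  have par : ∀ C : Submodule F (Matrix (Fin 3) (Fin 3) F) → Prop,
      (∀ W W', KEquiv F W W' → C W' → C W) → ∀ X,
      (∀ i, C (reps ν X i)) → ((3 : F) = 0 → C (parNet 1 1)) → ∀ s t, C (parNet s t) := by
    intro C hC X hR h
    exact of_parNet hC (hC _ _ parNet_zero_kEquiv (hR 4)) (hR 10) (hR 11) h
  by_cases h3 : (3 : F) = 0
  · refine ⟨_, .par h3, fun C hC hR => ⟨hyp C hC (exists_pow_three_of_three_eq_zero h3) _ hR,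
      ell C hC ?_ _ hR, par C hC _ hR fun _ => hR 14⟩⟩
    have h3K : (3 : QuadraticAlgebra F ν 0) = 0 := by
      rw [← map_ofNat (algebraMap F (QuadraticAlgebra F ν 0)) 3, h3, map_zero]
    intro τ hτ
    obtain ⟨κ, rfl⟩ := exists_pow_three_of_three_eq_zero h3K τ
    exact ⟨1, κ, one_ne_zero, by rintro rfl; simp at hτ, by simp⟩
  · rcases cubes_dichotomy (F := F) (K := QuadraticAlgebra F ν 0)
      (QuadraticAlgebra.finrank_eq_two ν 0) h3 with ⟨⟨x, hx0, hx⟩, hK⟩ | ⟨hF, δ, hδ0, hδ⟩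
    · obtain ⟨g, hg0, hg⟩ := exists_generator_mod_cubes_field F
      have hgc : ∀ y, g ≠ y ^ 3 := by
        rintro z rfl
        obtain ⟨y, -, rfl | rfl | rfl⟩ := hg x hx0
        · exact hx y rfl
        · exact hx (z * y) (by ring)
        · exact hx (z⁻¹ * y) (by ring)
      exact ⟨_, .hyp g hg0 hgc, fun C hC hR =>
        ⟨of_hypNet hC (hR 7) (hR 8) (of_hypNet_one hC g hg0 hg (hR 12) (hR 14)),
          ell C hC hK _ hR, par C hC _ hR fun h => absurd h h3⟩⟩
    · obtain ⟨γ, hγ0, hγ⟩ := exists_generator_mod_cubes_field (QuadraticAlgebra F ν 0)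
      have hγc : ∀ (m : F) κ, m ≠ 0 → γ ≠ m • κ ^ 3 := by
        rintro m κ hm rfl
        obtain ⟨m, rfl⟩ := hF m
        have hm0 : m ≠ 0 := by rintro rfl; simp at hm
        obtain ⟨y, -, rfl | rfl | rfl⟩ := hγ δ hδ0
        · exact hδ 1 y one_ne_zero (by simp)
        · refine hδ (m ^ 3) (κ * y) hm ?_
          rw [mul_pow, smul_mul_assoc]
        · refine hδ (m⁻¹ ^ 3) (κ⁻¹ * y) (by simp [hm0]) ?_
          simp only [Algebra.smul_def, mul_pow, mul_inv, inv_pow, map_pow, map_inv₀]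
          ring
      refine ⟨_, .ell γ hγ0 hγc, fun C hC hR => ⟨hyp C hC hF _ hR,
        of_ellNet hC hns γ ?_ (hR 9) (hR 13) (hR 14), par C hC _ hR fun h => absurd h h3⟩⟩
      intro τ hτ
      obtain ⟨y, hy, h | h | h⟩ := hγ τ hτ
      · exact ⟨1, y, one_ne_zero, hy, Or.inl (by simpa using h)⟩
      · exact ⟨1, y, one_ne_zero, hy, Or.inr (Or.inl (by rw [h, one_smul, mul_comm]))⟩
      · have hn : γ.norm ≠ 0 := by
          rwa [Ne, QuadraticAlgebra.norm_eq_zero_iff_eq_zero]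
        refine ⟨γ.norm⁻¹, y, inv_ne_zero hn, hy, Or.inr (Or.inr ?_)⟩
        rw [h, QuadraticAlgebra.inv_def, mul_comm, mul_smul_comm]

end Representatives

section General

variable {F : Type*} [Field F]

theorem exists_eq_smul_vecMulVec {M : Matrix (Fin 3) (Fin 3) F} (hM : M.IsSymm)
    (h : M.rank = 1) : ∃ (c : F) (a : Fin 3 → F), c ≠ 0 ∧ a ≠ 0 ∧ M = c • vecMulVec a a := by
  obtain ⟨⟨a, ha⟩, ha0, hspan⟩ := finrank_eq_one_iff'.1 h
  have ha0' : a ≠ 0 := fun h => ha0 (Subtype.ext h)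
  have hcol : ∀ j, ∃ b : F, ∀ i, M i j = b * a i := by
    intro j
    obtain ⟨b, hb⟩ := hspan ⟨M *ᵥ Pi.single j 1, ⟨_, rfl⟩⟩
    refine ⟨b, fun i => ?_⟩
    have := congrFun (congrArg Subtype.val hb) i
    simp at this
    exact this.symm
  choose b hb using hcol
  obtain ⟨k, hk⟩ := Function.ne_iff.1 ha0'
  have hk : a k ≠ 0 := hk
  have hba : ∀ j, b j = b k / a k * a j := by
    intro j
    have h1 := hM.apply j k
    rw [hb, hb] at h1
    field_simp
    linear_combination h1
  refine ⟨b k / a k, a, ?_, ha0', ?_⟩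
  · intro h0
    have : ∀ j, b j = 0 := by
      intro j; rw [hba, h0, zero_mul]
    obtain ⟨i, hi⟩ := Function.ne_iff.1 ha0'
    have hM0 : M = 0 := by
      ext i j
      simp [hb, this]
    rw [hM0] at h
    simp at h
  · ext i j
    simp only [Matrix.smul_apply, vecMulVec_apply, smul_eq_mul]
    rw [hb, hba]; ring

theorem exists_isUnit_mulVec_eq {a : Fin 3 → F} (ha : a ≠ 0) :
    ∃ A : Matrix (Fin 3) (Fin 3) F, IsUnit A ∧ A *ᵥ a = ![1, 0, 0] := by
  simp only [Matrix.isUnit_iff_isUnit_det, isUnit_iff_ne_zero]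
  by_cases h0 : a 0 = 0
  · by_cases h1 : a 1 = 0
    · have h2 : a 2 ≠ 0 := by
        intro h2
        apply ha
        ext i
        fin_cases i <;> simp [h0, h1, h2]
      refine ⟨!![0, 0, 1 / a 2; 0, 1, -a 1 / a 2; 1, 0, -a 0 / a 2], ?_, ?_⟩
      · simp [Matrix.det_fin_three, h2]
      · ext i
        fin_cases i <;> simp [Matrix.mulVec, dotProduct, Fin.sum_univ_three, h0, h1, h2]
    · refine ⟨!![0, 1 / a 1, 0; 1, -a 0 / a 1, 0; 0, -a 2 / a 1, 1], ?_, ?_⟩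
      · simp [Matrix.det_fin_three, h1]
      · ext i
        fin_cases i <;> simp [Matrix.mulVec, dotProduct, Fin.sum_univ_three, h0, h1]
  · refine ⟨!![1 / a 0, 0, 0; -a 1 / a 0, 1, 0; -a 2 / a 0, 0, 1], ?_, ?_⟩
    · simp [Matrix.det_fin_three, h0]
    · ext i
      fin_cases i <;> simp [Matrix.mulVec, dotProduct, Fin.sum_univ_three, h0]

theorem exists_span_ker {V : Type*} [AddCommGroup V] [Module F V] (h : Module.finrank F V = 3)
    (φ : V →ₗ[F] F) (e : V) (he : φ e = 1) :
    ∃ M N : V, φ M = 0 ∧ φ N = 0 ∧ (∀ X, ∃ a b c : F, a • e + b • M + c • N = X) ∧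
      ∀ x y : F, x • M + y • N = 0 → x = 0 ∧ y = 0 := by
  have : FiniteDimensional F V := FiniteDimensional.of_finrank_pos (by omega)
  have hφ : LinearMap.range φ = ⊤ := by
    rw [LinearMap.range_eq_top]
    intro x
    exact ⟨x • e, by simp [he]⟩
  have hker : Module.finrank F (LinearMap.ker φ) = 2 := by
    have := LinearMap.finrank_range_add_finrank_ker φ
    rw [hφ, h, finrank_top, Module.finrank_self] at this
    omega
  let b := Module.finBasisOfFinrankEq F (LinearMap.ker φ) hker
  refine ⟨b 0, b 1, (b 0).2, (b 1).2, fun X => ?_, fun x y hxy => ?_⟩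
  · let Y : LinearMap.ker φ := ⟨X - φ X • e, by simp [he]⟩
    have hY := b.sum_repr Y
    rw [Fin.sum_univ_two] at hY
    refine ⟨φ X, b.repr Y 0, b.repr Y 1, ?_⟩
    have := congrArg Subtype.val hY
    simp only [Submodule.coe_add, Submodule.coe_smul] at this
    rw [add_assoc, this]
    simp [Y]
  · have hli := Fintype.linearIndependent_iff.1 b.linearIndependent ![x, y]
      (by rw [Fin.sum_univ_two]; exact Subtype.ext hxy)
    exact ⟨hli 0, hli 1⟩

theorem exists_net_eq {W : Submodule F (Matrix (Fin 3) (Fin 3) F)} (hW : ∀ M ∈ W, M.IsSymm)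
    (h3 : Module.finrank F W = 3) (h1 : symMat 1 0 0 0 0 0 ∈ W) :
    ∃ m₁ m₂ p q r n₁ n₂ p' q' r' : F, W = net m₁ m₂ p q r n₁ n₂ p' q' r' ∧
      ∀ x y : F, x * m₁ + y * n₁ = 0 → x * m₂ + y * n₂ = 0 → x * p + y * p' = 0 →
        x * q + y * q' = 0 → x * r + y * r' = 0 → x = 0 ∧ y = 0 := by
  let φ : W →ₗ[F] F :=
    { toFun := fun M => (M : Matrix (Fin 3) (Fin 3) F) 0 0
      map_add' := fun _ _ => rfl
      map_smul' := fun _ _ => rfl }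
  obtain ⟨⟨M, hMW⟩, ⟨N, hNW⟩, hM0, hN0, hgen, hind⟩ :=
    exists_span_ker h3 φ ⟨_, h1⟩ (show symMat (1 : F) 0 0 0 0 0 0 0 = 1 from rfl)
  have hM0 : M 0 0 = 0 := hM0
  have hN0 : N 0 0 = 0 := hN0
  have hMs := eq_symMat (hW M hMW)
  have hNs := eq_symMat (hW N hNW)
  rw [hM0] at hMs
  rw [hN0] at hNs
  refine ⟨M 0 1, M 0 2, M 1 1, M 1 2, M 2 2, N 0 1, N 0 2, N 1 1, N 1 2, N 2 2, ?_, ?_⟩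
  · apply le_antisymm
    · intro X hX
      rw [net, ← hMs, ← hNs, Submodule.mem_span_triple]
      obtain ⟨a, b, c, h⟩ := hgen ⟨X, hX⟩
      exact ⟨a, b, c, congrArg Subtype.val h⟩
    · rw [net, ← hMs, ← hNs, Submodule.span_le]
      rintro X (rfl | rfl | rfl)
      · exact h1
      · exact hMW
      · exact hNW
  · intro x y e₁ e₂ e₃ e₄ e₅
    have hzero : x • M + y • N = 0 := by
      rw [hMs, hNs]
      ext i j
      fin_cases i <;> fin_cases j <;> simp [symMat, e₁, e₂, e₃, e₄, e₅]
    exact hind x y (Subtype.ext hzero)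

theorem exists_net_kEquiv {W : Submodule F (Matrix (Fin 3) (Fin 3) F)} (hW : ∀ M ∈ W, M.IsSymm)
    (h3 : Module.finrank F W = 3) (h1 : ∃ M ∈ W, M.rank = 1) :
    ∃ m₁ m₂ p q r n₁ n₂ p' q' r' : F, KEquiv F W (net m₁ m₂ p q r n₁ n₂ p' q' r') ∧
      ∀ x y : F, x * m₁ + y * n₁ = 0 → x * m₂ + y * n₂ = 0 → x * p + y * p' = 0 →
        x * q + y * q' = 0 → x * r + y * r' = 0 → x = 0 ∧ y = 0 := by
  obtain ⟨M, hM, hM1⟩ := h1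
  obtain ⟨c, a, hc, ha, rfl⟩ := exists_eq_smul_vecMulVec (hW M hM) hM1
  obtain ⟨A, hA, hAa⟩ := exists_isUnit_mulVec_eq ha
  let φ : Matrix (Fin 3) (Fin 3) F →ₗ[F] Matrix (Fin 3) (Fin 3) F :=
    { toFun := fun M => A * M * Aᵀ
      map_add' := fun M N => by rw [mul_add, add_mul]
      map_smul' := fun c M => by simp }
  have hφ : Function.Injective φ := by
    intro M N h
    have h : A * M * Aᵀ = A * N * Aᵀ := h
    have hAt : IsUnit Aᵀ := (Matrix.isUnit_transpose A).2 hA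
    exact hA.mul_left_cancel (hAt.mul_right_cancel h)
  have hk : KEquiv F W (W.map φ) := ⟨A, hA, rfl⟩
  have hsymm : ∀ M ∈ W.map φ, M.IsSymm := by
    rintro _ ⟨M, hM, rfl⟩
    have := hW M hM
    simp only [φ, LinearMap.coe_mk, AddHom.coe_mk, Matrix.IsSymm, Matrix.transpose_mul,
      Matrix.transpose_transpose, this.eq, Matrix.mul_assoc]
  have hrank : Module.finrank F (W.map φ) = 3 :=
    (LinearEquiv.finrank_eq (Submodule.equivMapOfInjective φ hφ W)).symm.trans h3
  have hmem : symMat 1 0 0 0 0 0 ∈ W.map φ := by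
    refine ⟨vecMulVec a a, ?_, ?_⟩
    · have := W.smul_mem c⁻¹ hM
      rwa [smul_smul, inv_mul_cancel₀ hc, one_smul] at this
    · change A * vecMulVec a a * Aᵀ = _
      rw [Matrix.mul_vecMulVec, Matrix.vecMulVec_mul, Matrix.vecMul_transpose, hAa]
      ext i j
      fin_cases i <;> fin_cases j <;> simp [symMat, vecMulVec_apply]
  obtain ⟨m₁, m₂, p, q, r, n₁, n₂, p', q', r', h, hind⟩ := exists_net_eq hsymm hrank hmem
  exact ⟨m₁, m₂, p, q, r, n₁, n₂, p', q', r', h ▸ hk, hind⟩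

theorem exists_nonsquare_of_odd [Fintype F] (hodd : Odd (Fintype.card F)) :
    (2 : F) ≠ 0 ∧ ∃ ν : F, (∀ s, ν ≠ s ^ 2) ∧
      ∀ d : F, d ≠ 0 → (∃ s, d = s ^ 2) ∨ ∃ s, d = ν * s ^ 2 := by
  have hchar : ringChar F ≠ 2 := by
    intro h
    have := FiniteField.even_card_iff_char_two.1 h
    rw [Nat.odd_iff] at hodd
    omega
  refine ⟨Ring.two_ne_zero hchar, ?_⟩
  obtain ⟨ν, hν⟩ := FiniteField.exists_nonsquare hchar
  have hν' : ∀ s, ν ≠ s ^ 2 := fun s h => hν ⟨s, by rw [h, sq]⟩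
  refine ⟨ν, hν', fun d hd => ?_⟩
  have hν0 : ν ≠ 0 := by simpa using hν' 0
  classical
  by_cases hs : IsSquare d
  · left
    obtain ⟨s, rfl⟩ := hs
    exact ⟨s, by ring⟩
  · right
    have h1 := quadraticChar_neg_one_iff_not_isSquare.2 hs
    have h2 := quadraticChar_neg_one_iff_not_isSquare.2 hν
    have h3 : IsSquare (d * ν) := by
      rw [← quadraticChar_one_iff_isSquare (mul_ne_zero hd hν0), map_mul, h1, h2]
      norm_num
    obtain ⟨s, hs⟩ := h3
    refine ⟨s / ν, ?_⟩
    field_simp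
    linear_combination hs

end General

section Representatives

variable {F : Type*} [Field F]

theorem symMat_one_mem_net (m₁ m₂ p q r n₁ n₂ p' q' r' : F) :
    symMat 1 0 0 0 0 0 ∈ net m₁ m₂ p q r n₁ n₂ p' q' r' :=
  Submodule.subset_span (by simp)

theorem isSymm_of_mem_net {m₁ m₂ p q r n₁ n₂ p' q' r' : F} {M : Matrix (Fin 3) (Fin 3) F}
    (h : M ∈ net m₁ m₂ p q r n₁ n₂ p' q' r') : M.IsSymm := by
  obtain ⟨a, b, c, rfl⟩ := mem_net.1 h
  exact symMat_isSymm ..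

theorem finrank_net {m₁ m₂ p q r n₁ n₂ p' q' r' : F}
    (h : ∀ x y : F, x * m₁ + y * n₁ = 0 → x * m₂ + y * n₂ = 0 → x * p + y * p' = 0 →
      x * q + y * q' = 0 → x * r + y * r' = 0 → x = 0 ∧ y = 0) :
    Module.finrank F (net m₁ m₂ p q r n₁ n₂ p' q' r') = 3 := by
  let v : Fin 3 → Matrix (Fin 3) (Fin 3) F :=
    ![symMat 1 0 0 0 0 0, symMat 0 m₁ m₂ p q r, symMat 0 n₁ n₂ p' q' r']
  have hv : LinearIndependent F v := by
    rw [Fintype.linearIndependent_iff]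
    intro g hg
    have h0 : symMat (0 : F) 0 0 0 0 0 = 0 := by
      ext i j
      fin_cases i <;> fin_cases j <;> rfl
    rw [Fin.sum_univ_three] at hg
    simp only [v, Matrix.cons_val] at hg
    rw [comb_eq, ← h0, symMat_inj] at hg
    obtain ⟨e₀, e₁, e₂, e₃, e₄, e₅⟩ := hg
    obtain ⟨e₆, e₇⟩ := h _ _ e₁ e₂ e₃ e₄ e₅
    intro i
    fin_cases i
    exacts [e₀, e₆, e₇]
  have hr : net m₁ m₂ p q r n₁ n₂ p' q' r' = Submodule.span F (Set.range v) := by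
    simp only [v, net, Matrix.range_cons, Matrix.range_empty, Set.union_empty,
      Set.singleton_union]
  rw [hr, finrank_span_eq_card hv, Fintype.card_fin]

theorem rank_symMat_one : (symMat (1 : F) 0 0 0 0 0).rank = 1 := by
  have h : symMat (1 : F) 0 0 0 0 0 = vecMulVec ![1, 0, 0] ![1, 0, 0] := by
    ext i j
    fin_cases i <;> fin_cases j <;> simp [symMat, vecMulVec_apply]
  apply le_antisymm
  · rw [h]
    exact Matrix.rank_vecMulVec_le ..
  · rw [Nat.one_le_iff_ne_zero]
    intro h0
    rw [Matrix.rank, Submodule.finrank_eq_zero, LinearMap.range_eq_bot] at h0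
    have h1 := congrFun (LinearMap.congr_fun h0 ![1, 0, 0]) 0
    simp [symMat, dotProduct, Matrix.mulVec, Fin.sum_univ_three] at h1

theorem exists_reps_eq_net {ν : F} {X : Submodule F (Matrix (Fin 3) (Fin 3) F)}
    (hX : IsExceptional ν X) (i : Fin 15) :
    ∃ m₁ m₂ p q r n₁ n₂ p' q' r' : F, reps ν X i = net m₁ m₂ p q r n₁ n₂ p' q' r' ∧
      ∀ x y : F, x * m₁ + y * n₁ = 0 → x * m₂ + y * n₂ = 0 → x * p + y * p' = 0 →
        x * q + y * q' = 0 → x * r + y * r' = 0 → x = 0 ∧ y = 0 := by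
  fin_cases i
  on_goal 15 => cases hX
  all_goals
    refine ⟨_, _, _, _, _, _, _, _, _, _, rfl, ?_⟩
    simp +contextual

end Representatives

section Invariants

variable {F : Type*} [Field F]

/-- Two independent squares of linear forms lie in `W`. -/
def HasTwoSquares (W : Submodule F (Matrix (Fin 3) (Fin 3) F)) : Prop :=
  ∃ v w : Fin 3 → F, v ≠ 0 ∧ (∀ c : F, w ≠ c • v) ∧ vecMulVec v v ∈ W ∧ vecMulVec w w ∈ W

/-- Three independent squares of linear forms lie in `W`. -/
def HasThreeSquares (W : Submodule F (Matrix (Fin 3) (Fin 3) F)) : Prop :=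
  ∃ u v w : Fin 3 → F, (Matrix.of ![u, v, w]).det ≠ 0 ∧
    vecMulVec u u ∈ W ∧ vecMulVec v v ∈ W ∧ vecMulVec w w ∈ W

/-- `W` contains a line tangent to the Veronese surface. -/
def HasTangent (W : Submodule F (Matrix (Fin 3) (Fin 3) F)) : Prop :=
  ∃ v w : Fin 3 → F, v ≠ 0 ∧ (∀ c : F, w ≠ c • v) ∧ vecMulVec v v ∈ W ∧
    vecMulVec v w + vecMulVec w v ∈ W

/-- All elements of `W` are singular. -/
def IsSingular (W : Submodule F (Matrix (Fin 3) (Fin 3) F)) : Prop :=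
  ∀ M ∈ W, M.det = 0

/-- The discriminant is invariant under translation by a nonzero element of `W`. -/
def HasVertex (W : Submodule F (Matrix (Fin 3) (Fin 3) F)) : Prop :=
  ∃ M ∈ W, M ≠ 0 ∧ ∀ N ∈ W, (N + M).det = N.det

/-- The increment of the discriminant in the direction of a square in `W` takes a nonzero value in
the square class of `μ`. -/
def Represents (μ : F) (W : Submodule F (Matrix (Fin 3) (Fin 3) F)) : Prop :=
  ∃ v, vecMulVec v v ∈ W ∧ ∃ M ∈ W, ∃ c : F, c ≠ 0 ∧
    (M + vecMulVec v v).det - M.det = μ * c ^ 2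

/-- The increment of the discriminant in the direction of a square in `W` vanishes somewhere outside
of that direction. -/
def IsIsotropic (W : Submodule F (Matrix (Fin 3) (Fin 3) F)) : Prop :=
  ∃ v, v ≠ 0 ∧ vecMulVec v v ∈ W ∧ ∃ M ∈ W, (∀ c : F, M ≠ c • vecMulVec v v) ∧
    (M + vecMulVec v v).det = M.det

theorem mul_vecMulVec_mul (A : Matrix (Fin 3) (Fin 3) F) (v w : Fin 3 → F) :
    A * vecMulVec v w * Aᵀ = vecMulVec (A *ᵥ v) (A *ᵥ w) := by
  rw [Matrix.mul_vecMulVec, Matrix.vecMulVec_mul, Matrix.vecMul_transpose]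

theorem exists_of_kEquiv {W W' : Submodule F (Matrix (Fin 3) (Fin 3) F)} (h : KEquiv F W W') :
    ∃ A : Matrix (Fin 3) (Fin 3) F, A.det ≠ 0 ∧ (∀ M ∈ W, A * M * Aᵀ ∈ W') ∧
      ∀ N ∈ W', ∃ M ∈ W, A * M * Aᵀ = N := by
  obtain ⟨A, hA, h⟩ := h
  refine ⟨A, ?_, fun M hM => ?_, fun N hN => ?_⟩
  · rwa [Matrix.isUnit_iff_isUnit_det, isUnit_iff_ne_zero] at hA
  · rw [← SetLike.mem_coe, h]
    exact ⟨M, hM, rfl⟩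
  · rwa [← SetLike.mem_coe, h] at hN

theorem mulVec_ne_zero {A : Matrix (Fin 3) (Fin 3) F} (hA : A.det ≠ 0) {v : Fin 3 → F}
    (hv : v ≠ 0) : A *ᵥ v ≠ 0 := fun h =>
  hv (Matrix.eq_zero_of_mulVec_eq_zero hA h)

theorem mulVec_ne_smul {A : Matrix (Fin 3) (Fin 3) F} (hA : A.det ≠ 0) {v w : Fin 3 → F}
    (h : ∀ c : F, w ≠ c • v) (c : F) : A *ᵥ w ≠ c • (A *ᵥ v) := fun e =>
  h c (sub_eq_zero.1 (Matrix.eq_zero_of_mulVec_eq_zero hA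
    (by rw [Matrix.mulVec_sub, Matrix.mulVec_smul, e, sub_self])))

theorem mul_mul_transpose_injective {A : Matrix (Fin 3) (Fin 3) F} (hA : A.det ≠ 0)
    {M N : Matrix (Fin 3) (Fin 3) F} (h : A * M * Aᵀ = A * N * Aᵀ) : M = N := by
  have hA' : IsUnit A := (Matrix.isUnit_iff_isUnit_det A).2 (isUnit_iff_ne_zero.2 hA)
  exact hA'.mul_left_cancel (((Matrix.isUnit_transpose A).2 hA').mul_right_cancel h)

theorem det_mul_mul_transpose (A M : Matrix (Fin 3) (Fin 3) F) :
    (A * M * Aᵀ).det = A.det ^ 2 * M.det := by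
  rw [Matrix.det_mul, Matrix.det_mul, Matrix.det_transpose]
  ring

theorem mul_add_mul_transpose (A M N : Matrix (Fin 3) (Fin 3) F) :
    A * M * Aᵀ + A * N * Aᵀ = A * (M + N) * Aᵀ := by
  rw [mul_add, add_mul]

variable {W W' : Submodule F (Matrix (Fin 3) (Fin 3) F)}

theorem HasTwoSquares.of_kEquiv (h : KEquiv F W W') (hW : HasTwoSquares W) :
    HasTwoSquares W' := by
  obtain ⟨A, hA, h₁, -⟩ := exists_of_kEquiv h
  obtain ⟨v, w, hv, hw, hvW, hwW⟩ := hW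
  refine ⟨A *ᵥ v, A *ᵥ w, mulVec_ne_zero hA hv, mulVec_ne_smul hA hw, ?_, ?_⟩
  · simpa only [mul_vecMulVec_mul] using h₁ _ hvW
  · simpa only [mul_vecMulVec_mul] using h₁ _ hwW

theorem HasThreeSquares.of_kEquiv (h : KEquiv F W W') (hW : HasThreeSquares W) :
    HasThreeSquares W' := by
  obtain ⟨A, hA, h₁, -⟩ := exists_of_kEquiv h
  obtain ⟨u, v, w, hd, hu, hv, hw⟩ := hW
  refine ⟨A *ᵥ u, A *ᵥ v, A *ᵥ w, ?_, ?_, ?_, ?_⟩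
  · have : Matrix.of ![A *ᵥ u, A *ᵥ v, A *ᵥ w] = Matrix.of ![u, v, w] * Aᵀ := by
      ext i j
      fin_cases i <;> simp [Matrix.mul_apply, Matrix.mulVec, dotProduct, mul_comm]
    rw [this, Matrix.det_mul, Matrix.det_transpose]
    exact mul_ne_zero hd hA
  · simpa only [mul_vecMulVec_mul] using h₁ _ hu
  · simpa only [mul_vecMulVec_mul] using h₁ _ hv
  · simpa only [mul_vecMulVec_mul] using h₁ _ hw

theorem HasTangent.of_kEquiv (h : KEquiv F W W') (hW : HasTangent W) : HasTangent W' := by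
  obtain ⟨A, hA, h₁, -⟩ := exists_of_kEquiv h
  obtain ⟨v, w, hv, hw, hvW, hwW⟩ := hW
  refine ⟨A *ᵥ v, A *ᵥ w, mulVec_ne_zero hA hv, mulVec_ne_smul hA hw, ?_, ?_⟩
  · simpa only [mul_vecMulVec_mul] using h₁ _ hvW
  · simpa only [mul_vecMulVec_mul, ← mul_add_mul_transpose] using h₁ _ hwW

theorem IsSingular.of_kEquiv (h : KEquiv F W W') (hW : IsSingular W) : IsSingular W' := by
  obtain ⟨A, hA, -, h₂⟩ := exists_of_kEquiv h
  intro N hN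
  obtain ⟨M, hM, rfl⟩ := h₂ N hN
  rw [det_mul_mul_transpose, hW M hM, mul_zero]

theorem HasVertex.of_kEquiv (h : KEquiv F W W') (hW : HasVertex W) : HasVertex W' := by
  obtain ⟨A, hA, h₁, h₂⟩ := exists_of_kEquiv h
  obtain ⟨M, hM, hM0, hdet⟩ := hW
  refine ⟨_, h₁ M hM, fun h0 => hM0 (mul_mul_transpose_injective hA (by simpa using h0)), ?_⟩
  intro N' hN'
  obtain ⟨N, hN, rfl⟩ := h₂ N' hN'
  rw [mul_add_mul_transpose, det_mul_mul_transpose, det_mul_mul_transpose, hdet N hN]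

theorem Represents.of_kEquiv {μ : F} (h : KEquiv F W W') (hW : Represents μ W) :
    Represents μ W' := by
  obtain ⟨A, hA, h₁, -⟩ := exists_of_kEquiv h
  obtain ⟨v, hv, M, hM, c, hc, hdet⟩ := hW
  refine ⟨A *ᵥ v, ?_, _, h₁ M hM, A.det * c, mul_ne_zero hA hc, ?_⟩
  · simpa only [mul_vecMulVec_mul] using h₁ _ hv
  · rw [← mul_vecMulVec_mul, mul_add_mul_transpose, det_mul_mul_transpose, det_mul_mul_transpose]
    linear_combination A.det ^ 2 * hdet

theorem IsIsotropic.of_kEquiv (h : KEquiv F W W') (hW : IsIsotropic W) : IsIsotropic W' := by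
  obtain ⟨A, hA, h₁, -⟩ := exists_of_kEquiv h
  obtain ⟨v, hv0, hv, M, hM, hM', hdet⟩ := hW
  refine ⟨A *ᵥ v, mulVec_ne_zero hA hv0, ?_, _, h₁ M hM, fun c e => hM' c ?_, ?_⟩
  · simpa only [mul_vecMulVec_mul] using h₁ _ hv
  · apply mul_mul_transpose_injective hA
    rw [e, ← mul_vecMulVec_mul]
    simp
  · rw [← mul_vecMulVec_mul, mul_add_mul_transpose, det_mul_mul_transpose, det_mul_mul_transpose,
      hdet]

end Invariants

section NetInvariants

variable {F : Type*} [Field F] {m₁ m₂ p q r n₁ n₂ p' q' r' : F}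

theorem symMat_mem_net {a b c d e f : F} :
    symMat a b c d e f ∈ net m₁ m₂ p q r n₁ n₂ p' q' r' ↔ ∃ x y : F,
      x * m₁ + y * n₁ = b ∧ x * m₂ + y * n₂ = c ∧ x * p + y * p' = d ∧ x * q + y * q' = e ∧
        x * r + y * r' = f := by
  simp only [mem_net, symMat_inj]
  constructor
  · rintro ⟨_, x, y, _, h⟩
    exact ⟨x, y, h⟩
  · rintro ⟨x, y, h⟩
    exact ⟨a, x, y, rfl, h⟩

theorem vecMulVec_add_vecMulVec (v w : Fin 3 → F) :
    vecMulVec v w + vecMulVec w v = symMat (v 0 * w 0 + w 0 * v 0) (v 0 * w 1 + w 0 * v 1)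
      (v 0 * w 2 + w 0 * v 2) (v 1 * w 1 + w 1 * v 1) (v 1 * w 2 + w 1 * v 2)
      (v 2 * w 2 + w 2 * v 2) := by
  ext i j
  fin_cases i <;> fin_cases j <;> simp [symMat, vecMulVec_apply] <;> ring

theorem vecMulVec_self (v : Fin 3 → F) :
    vecMulVec v v = symMat (v 0 * v 0) (v 0 * v 1) (v 0 * v 2) (v 1 * v 1) (v 1 * v 2)
      (v 2 * v 2) := by
  ext i j
  fin_cases i <;> fin_cases j <;> simp [symMat, vecMulVec_apply] <;> ring

theorem symMat_add (a b c d e f a' b' c' d' e' f' : F) :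
    symMat a b c d e f + symMat a' b' c' d' e' f' =
      symMat (a + a') (b + b') (c + c') (d + d') (e + e') (f + f') := by
  ext i j
  fin_cases i <;> fin_cases j <;> simp [symMat]

/-- Multiples of the first coordinate vector are the only vectors whose square lies in `W`. -/
def HasOneSquare (W : Submodule F (Matrix (Fin 3) (Fin 3) F)) : Prop :=
  ∀ v : Fin 3 → F, vecMulVec v v ∈ W → v 1 = 0 ∧ v 2 = 0

theorem eq_smul_of_tail_eq_zero {v w : Fin 3 → F} (hv : v ≠ 0) (h₁ : v 1 = 0) (h₂ : v 2 = 0)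
    (h₃ : w 1 = 0) (h₄ : w 2 = 0) : w = (w 0 / v 0) • v := by
  have h : v 0 ≠ 0 := by
    intro h
    apply hv
    ext i
    fin_cases i <;> assumption
  ext i
  fin_cases i <;> simp [h, h₁, h₂, h₃, h₄]

theorem HasOneSquare.not_hasTwoSquares {W : Submodule F (Matrix (Fin 3) (Fin 3) F)}
    (h : HasOneSquare W) : ¬ HasTwoSquares W := by
  rintro ⟨v, w, hv, hw, hvW, hwW⟩
  obtain ⟨h₁, h₂⟩ := h v hvW
  obtain ⟨h₃, h₄⟩ := h w hwW
  exact hw _ (eq_smul_of_tail_eq_zero hv h₁ h₂ h₃ h₄)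

theorem vecMulVec_one_mem_net :
    vecMulVec ![1, 0, 0] ![1, 0, 0] ∈ net m₁ m₂ p q r n₁ n₂ p' q' r' := by
  rw [vecMulVec_self, symMat_mem_net]
  exact ⟨0, 0, by simp⟩

theorem ne_smul_one {w : Fin 3 → F} (h : w 1 ≠ 0 ∨ w 2 ≠ 0) (c : F) : w ≠ c • ![1, 0, 0] := by
  rintro rfl
  simp at h

theorem one_vec_ne_zero : (![1, 0, 0] : Fin 3 → F) ≠ 0 := fun h =>
  one_ne_zero (congrFun h 0)

theorem hasTwoSquares_net (v : Fin 3 → F) (hv : v 1 ≠ 0 ∨ v 2 ≠ 0)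
    (h : vecMulVec v v ∈ net m₁ m₂ p q r n₁ n₂ p' q' r') :
    HasTwoSquares (net m₁ m₂ p q r n₁ n₂ p' q' r') :=
  ⟨_, v, one_vec_ne_zero, ne_smul_one hv, vecMulVec_one_mem_net, h⟩

theorem hasTangent_net (x y : F) (h : x * m₁ + y * n₁ ≠ 0 ∨ x * m₂ + y * n₂ ≠ 0)
    (h₁ : x * p + y * p' = 0) (h₂ : x * q + y * q' = 0) (h₃ : x * r + y * r' = 0) :
    HasTangent (net m₁ m₂ p q r n₁ n₂ p' q' r') := by
  refine ⟨_, ![0, x * m₁ + y * n₁, x * m₂ + y * n₂], one_vec_ne_zero, ne_smul_one h,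
    vecMulVec_one_mem_net, ?_⟩
  rw [vecMulVec_add_vecMulVec, symMat_mem_net]
  exact ⟨x, y, by simp [h₁, h₂, h₃]⟩

theorem not_hasTangent_net (h : HasOneSquare (net m₁ m₂ p q r n₁ n₂ p' q' r'))
    (hb : ∀ x y, x * p + y * p' = 0 → x * q + y * q' = 0 → x * r + y * r' = 0 →
      x * m₁ + y * n₁ = 0 ∧ x * m₂ + y * n₂ = 0) :
    ¬ HasTangent (net m₁ m₂ p q r n₁ n₂ p' q' r') := by
  rintro ⟨v, w, hv, hw, hvW, hwW⟩
  obtain ⟨h₁, h₂⟩ := h v hvW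
  have h₀ : v 0 ≠ 0 := by
    intro h
    apply hv
    ext i
    fin_cases i <;> assumption
  rw [vecMulVec_add_vecMulVec, symMat_mem_net] at hwW
  obtain ⟨x, y, e₁, e₂, e₃, e₄, e₅⟩ := hwW
  simp only [h₁, h₂, mul_zero, zero_mul, add_zero] at e₁ e₂ e₃ e₄ e₅
  obtain ⟨h₃, h₄⟩ := hb x y e₃ e₄ e₅
  rw [h₃, eq_comm, mul_eq_zero] at e₁
  rw [h₄, eq_comm, mul_eq_zero] at e₂
  exact hw _ (eq_smul_of_tail_eq_zero hv h₁ h₂ (e₁.resolve_left h₀) (e₂.resolve_left h₀))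

theorem det_symMat_add_sub (a b c d e f : F) {v : Fin 3 → F} (h₁ : v 1 = 0) (h₂ : v 2 = 0) :
    (symMat a b c d e f + vecMulVec v v).det - (symMat a b c d e f).det =
      v 0 ^ 2 * (d * f - e ^ 2) := by
  rw [vecMulVec_self, symMat_add, det_symMat, det_symMat, h₁, h₂]
  ring

theorem represents_net {μ : F} (x y z : F) (hz : z ≠ 0)
    (h : (x * p + y * p') * (x * r + y * r') - (x * q + y * q') ^ 2 = μ * z ^ 2) :
    Represents μ (net m₁ m₂ p q r n₁ n₂ p' q' r') := by
  refine ⟨_, vecMulVec_one_mem_net, _, mem_net.2 ⟨0, x, y, rfl⟩, z, hz, ?_⟩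
  rw [det_symMat_add_sub _ _ _ _ _ _ (by simp) (by simp), ← h]
  simp

theorem not_represents_net {μ : F} (h : HasOneSquare (net m₁ m₂ p q r n₁ n₂ p' q' r'))
    (hb : ∀ u x y z : F, z ≠ 0 →
      u ^ 2 * ((x * p + y * p') * (x * r + y * r') - (x * q + y * q') ^ 2) ≠ μ * z ^ 2) :
    ¬ Represents μ (net m₁ m₂ p q r n₁ n₂ p' q' r') := by
  rintro ⟨v, hv, M, hM, z, hz, e⟩
  obtain ⟨h₁, h₂⟩ := h v hv
  obtain ⟨a, x, y, rfl⟩ := mem_net.1 hM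
  rw [det_symMat_add_sub _ _ _ _ _ _ h₁ h₂] at e
  exact hb _ _ _ _ hz e

theorem isIsotropic_net (x y : F) (hb : x * p + y * p' ≠ 0 ∨ x * r + y * r' ≠ 0)
    (h : (x * p + y * p') * (x * r + y * r') - (x * q + y * q') ^ 2 = 0) :
    IsIsotropic (net m₁ m₂ p q r n₁ n₂ p' q' r') := by
  refine ⟨_, one_vec_ne_zero, vecMulVec_one_mem_net, _, mem_net.2 ⟨0, x, y, rfl⟩, ?_, ?_⟩
  · intro c e
    have e₁ := congrFun (congrFun e 1) 1
    have e₂ := congrFun (congrFun e 2) 2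
    simp [symMat] at e₁ e₂
    simp [e₁, e₂] at hb
  · rw [← sub_eq_zero, det_symMat_add_sub _ _ _ _ _ _ (by simp) (by simp), h, mul_zero]

theorem not_isIsotropic_net (h : HasOneSquare (net m₁ m₂ p q r n₁ n₂ p' q' r'))
    (hb : ∀ x y : F, (x * p + y * p') * (x * r + y * r') - (x * q + y * q') ^ 2 = 0 →
      x = 0 ∧ y = 0) :
    ¬ IsIsotropic (net m₁ m₂ p q r n₁ n₂ p' q' r') := by
  rintro ⟨v, hv0, hv, M, hM, hM', e⟩
  obtain ⟨h₁, h₂⟩ := h v hv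
  have h₀ : v 0 ≠ 0 := by
    intro h
    apply hv0
    ext i
    fin_cases i <;> assumption
  obtain ⟨a, x, y, rfl⟩ := mem_net.1 hM
  rw [← sub_eq_zero, det_symMat_add_sub _ _ _ _ _ _ h₁ h₂, mul_eq_zero] at e
  obtain ⟨rfl, rfl⟩ := hb _ _ (e.resolve_left (pow_ne_zero 2 h₀))
  apply hM' (a / v 0 ^ 2)
  ext i j
  fin_cases i <;> fin_cases j <;> simp [symMat, vecMulVec_apply, h₁, h₂]
  field_simp

end NetInvariants

section Kinds

variable {F : Type*} [Field F]

/-- The families of nets that are told apart by the invariants above. -/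
inductive HasKind (ν : F) : Fin 13 → Submodule F (Matrix (Fin 3) (Fin 3) F) → Prop
  | zero : HasKind ν 0 (net 1 0 0 0 0 0 1 0 0 0)
  | one : HasKind ν 1 (net 0 0 1 0 0 1 0 0 0 0)
  | two : HasKind ν 2 (net 0 0 0 1 0 1 0 0 0 0)
  | three : HasKind ν 3 (net 0 0 0 1 0 1 1 0 0 0)
  | four : HasKind ν 4 (net 0 0 1 0 (-ν) 1 0 0 0 0)
  | five : HasKind ν 5 (net 0 0 1 0 0 0 1 0 0 0)
  | six : HasKind ν 6 (net 0 1 1 0 0 1 0 0 0 0)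
  | seven : HasKind ν 7 (hypNet 0 0)
  | eight : HasKind ν 8 (hypNet 1 0)
  | nine : HasKind ν 9 (parNet 0 1)
  | ten (s t : F) (hs : s ≠ 0) (ht : t ≠ 0) : HasKind ν 10 (hypNet s t)
  | eleven (s t : F) (hs : s ≠ 0) : HasKind ν 11 (parNet s t)
  | twelve (x y : F) : HasKind ν 12 (ellNet ν x y)

variable {ν : F} {k : Fin 13} {W : Submodule F (Matrix (Fin 3) (Fin 3) F)}

theorem eq_zero_of_sq_eq_mul_sq (hν : ∀ s : F, ν ≠ s ^ 2) {a b : F} (h : a ^ 2 = ν * b ^ 2) :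
    a = 0 ∧ b = 0 := by
  have hb : b = 0 := by
    by_contra hb
    exact hν (a / b) (by field_simp; exact h.symm)
  subst hb
  simpa using h

theorem HasKind.hasOneSquare (hν : ∀ s : F, ν ≠ s ^ 2) (h : HasKind ν k W)
    (hk : k = 0 ∨ k = 2 ∨ k = 3 ∨ k = 4 ∨ k = 6 ∨ 10 ≤ k) : HasOneSquare W := by
  intro v hv
  have hν0 : ν ≠ 0 := by simpa using hν 0
  cases h
  case one | five | seven | eight | nine => exact absurd hk (by decide)
  all_goals
    rw [vecMulVec_self, symMat_mem_net] at hv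
    obtain ⟨x, y, e₁, e₂, e₃, e₄, e₅⟩ := hv
  case twelve =>
    exact eq_zero_of_sq_eq_mul_sq hν (by linear_combination ν * e₅ - e₃)
  all_goals grind

theorem HasKind.hasTwoSquares_iff (hν : ∀ s : F, ν ≠ s ^ 2) (h : HasKind ν k W) :
    HasTwoSquares W ↔ k = 1 ∨ k = 5 ∨ k = 7 ∨ k = 8 ∨ k = 9 := by
  have h' := h.hasOneSquare hν
  cases h
  case eight =>
    refine iff_of_true (hasTwoSquares_net ![0, 0, 1] (by simp) ?_) (by decide)
    rw [vecMulVec_self, symMat_mem_net]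
    exact ⟨0, 1, by simp⟩
  case one | five | seven | nine =>
    refine iff_of_true (hasTwoSquares_net ![0, 1, 0] (by simp) ?_) (by decide)
    rw [vecMulVec_self, symMat_mem_net]
    exact ⟨1, 0, by simp⟩
  all_goals exact iff_of_false (h' (by decide)).not_hasTwoSquares (by decide)

theorem exists_eq_smul {v w : Fin 3 → F} (hv : v ≠ 0) (h : ∀ i j, v i * w j = v j * w i) :
    ∃ c : F, w = c • v := by
  obtain ⟨i, hi⟩ := Function.ne_iff.1 hv
  have hi : v i ≠ 0 := hi
  refine ⟨w i / v i, funext fun j => ?_⟩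
  simp only [Pi.smul_apply, smul_eq_mul]
  field_simp
  linear_combination h i j

theorem HasKind.hasTangent_iff (hν : ∀ s : F, ν ≠ s ^ 2) (h : HasKind ν k W) :
    HasTangent W ↔ k < 7 := by
  have h' := h.hasOneSquare hν
  cases h
  case seven | eight | nine =>
    refine iff_of_false ?_ (by decide)
    rintro ⟨v, w, hv, hw, hvW, hwW⟩
    rw [vecMulVec_self, symMat_mem_net] at hvW
    rw [vecMulVec_add_vecMulVec, symMat_mem_net] at hwW
    obtain ⟨x, y, e₁, e₂, e₃, e₄, e₅⟩ := hvW
    obtain ⟨x', y', f₁, f₂, f₃, f₄, f₅⟩ := hwW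
    simp only [mul_zero, mul_one, add_zero, zero_add] at e₁ e₂ e₃ e₄ e₅ f₁ f₂ f₃ f₄ f₅
    suffices h : v 0 * w 1 = v 1 * w 0 ∧ v 0 * w 2 = v 2 * w 0 ∧ v 1 * w 2 = v 2 * w 1 by
      obtain ⟨h₁, h₂, h₃⟩ := h
      obtain ⟨c, hc⟩ := exists_eq_smul hv (w := w) (by
        intro i j
        fin_cases i <;> fin_cases j <;> simp [h₁, h₂, h₃])
      exact hw c hc
    grind
  case ten | eleven | twelve =>
    refine iff_of_false (not_hasTangent_net (h' (by decide)) ?_) (by decide)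
    simp +contextual
  case zero | one | two | three | four | six =>
    exact iff_of_true (hasTangent_net 0 1 (by simp) (by simp) (by simp) (by simp)) (by decide)
  case five =>
    exact iff_of_true (hasTangent_net 0 1 (by simp) (by simp) (by simp) (by simp)) (by decide)

theorem HasKind.isSingular_iff (hν : ∀ s : F, ν ≠ s ^ 2) (h : HasKind ν k W) (hk : k < 7) :
    IsSingular W ↔ k < 2 := by
  have hν0 : ν ≠ 0 := by simpa using hν 0
  cases h
  case zero | one =>
    refine iff_of_true (fun M hM => ?_) (by decide)
    obtain ⟨a, b, c, rfl⟩ := mem_net.1 hM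
    rw [det_symMat]
    ring
  case two | three | four | six =>
    refine iff_of_false (fun h => ?_) (by decide)
    have := h _ (mem_net.2 ⟨1, 1, 0, rfl⟩)
    simp [det_symMat, hν0] at this
  case five =>
    refine iff_of_false (fun h => ?_) (by decide)
    have := h _ (mem_net.2 ⟨1, 1, 1, rfl⟩)
    simp [det_symMat] at this
  all_goals exact absurd hk (by decide)

theorem HasKind.represents_neg_one_iff (hν : ∀ s : F, ν ≠ s ^ 2) (h : HasKind ν k W)
    (hk : k = 2 ∨ k = 3 ∨ k = 4 ∨ k = 6) : Represents (-1) W ↔ k = 2 ∨ k = 3 := by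
  have h' := h.hasOneSquare hν
  have hν0 : ν ≠ 0 := by simpa using hν 0
  cases h
  case two | three =>
    exact iff_of_true (represents_net 1 0 1 one_ne_zero (by ring)) (by decide)
  case four =>
    refine iff_of_false (not_represents_net (h' (by decide)) fun u x y z hz e => hz ?_) (by decide)
    exact (eq_zero_of_sq_eq_mul_sq (a := z) (b := u * x) hν (by linear_combination e)).1
  case six =>
    refine iff_of_false (not_represents_net (h' (by decide)) fun u x y z hz e => hz ?_) (by decide)
    simpa using e
  all_goals exact absurd hk (by decide)

theorem HasKind.represents_neg_iff (hν : ∀ s : F, ν ≠ s ^ 2) (h : HasKind ν k W)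
    (hk : k = 4 ∨ k = 6 ∨ k = 10 ∨ k = 11) : Represents (-ν) W ↔ k = 4 ∨ k = 10 := by
  have h' := h.hasOneSquare hν
  have hν0 : ν ≠ 0 := by simpa using hν 0
  cases h
  case four =>
    exact iff_of_true (represents_net 1 0 1 one_ne_zero (by ring)) (by decide)
  case ten =>
    exact iff_of_true (represents_net 1 (-ν) 1 one_ne_zero (by ring)) (by decide)
  case six =>
    refine iff_of_false (not_represents_net (h' (by decide)) fun u x y z hz e => hz ?_) (by decide)
    simpa [hν0] using e
  case eleven =>
    refine iff_of_false (not_represents_net (h' (by decide)) fun u x y z hz e => hz ?_) (by decide)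
    exact (eq_zero_of_sq_eq_mul_sq (a := u * y) hν (by linear_combination -e)).2
  all_goals exact absurd hk (by decide)

theorem HasKind.isIsotropic_iff (hν : ∀ s : F, ν ≠ s ^ 2) (h : HasKind ν k W) (hk : 10 ≤ k) :
    IsIsotropic W ↔ k < 12 := by
  have h' := h.hasOneSquare hν
  cases h
  case ten | eleven =>
    exact iff_of_true (isIsotropic_net 1 0 (by simp) (by simp)) (by decide)
  case twelve =>
    refine iff_of_false (not_isIsotropic_net (h' (by decide)) fun x y e => ?_) (by decide)
    exact (eq_zero_of_sq_eq_mul_sq hν (by linear_combination -e)).symm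
  all_goals exact absurd hk (by decide)

theorem symMat_ne_zero {a b c d e f : F} (h : a ≠ 0 ∨ b ≠ 0 ∨ c ≠ 0 ∨ d ≠ 0 ∨ e ≠ 0 ∨ f ≠ 0) :
    symMat a b c d e f ≠ 0 := by
  intro h0
  have h1 : symMat (0 : F) 0 0 0 0 0 = 0 := by
    ext i j
    fin_cases i <;> fin_cases j <;> rfl
  rw [← h1, symMat_inj] at h0
  tauto

theorem HasKind.hasVertex_iff (h2 : (2 : F) ≠ 0) (h : HasKind ν k W)
    (hk : k = 2 ∨ k = 3 ∨ k = 8 ∨ k = 9) : HasVertex W ↔ k = 2 ∨ k = 9 := by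
  cases h
  case two =>
    refine iff_of_true ⟨_, mem_net.2 ⟨0, 0, 1, rfl⟩, symMat_ne_zero (by simp), fun N hN => ?_⟩
      (by decide)
    obtain ⟨a, b, c, rfl⟩ := mem_net.1 hN
    rw [symMat_add, det_symMat, det_symMat]
    ring
  case nine =>
    refine iff_of_true ⟨_, mem_net.2 ⟨1, -1, 0, rfl⟩, symMat_ne_zero (by simp), fun N hN => ?_⟩
      (by decide)
    obtain ⟨a, b, c, rfl⟩ := mem_net.1 hN
    rw [symMat_add, det_symMat, det_symMat]
    ring
  case three =>
    refine iff_of_false ?_ (by decide)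
    rintro ⟨M, hM, hM0, h⟩
    obtain ⟨α, β, γ, rfl⟩ := mem_net.1 hM
    have key : ∀ a b c : F, 2 * (c + γ) ^ 2 * (b + β) - (a + α) * (b + β) ^ 2 =
        2 * c ^ 2 * b - a * b ^ 2 := by
      intro a b c
      have := h _ (mem_net.2 ⟨a, b, c, rfl⟩)
      rw [symMat_add, det_symMat, det_symMat] at this
      linear_combination this
    have hβ : β = 0 := by simpa [h2] using key 0 (-β) 1
    subst hβ
    have hα : 2 * γ ^ 2 - α = 0 := by linear_combination key 0 1 0
    have hγ : γ = 0 := by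
      have h4 : (2 * 2) * γ = 0 := by linear_combination key 0 1 1 - hα
      simpa [h2] using h4
    subst hγ
    have hα : α = 0 := by simpa using hα
    subst hα
    apply hM0
    ext i j
    fin_cases i <;> fin_cases j <;> simp [symMat]
  case eight =>
    refine iff_of_false ?_ (by decide)
    rintro ⟨M, hM, hM0, h⟩
    obtain ⟨α, β, γ, rfl⟩ := mem_net.1 hM
    have key : ∀ a b c : F, (a + α) * (b + β) * (c + γ) - (b + β) ^ 3 = a * b * c - b ^ 3 := by
      intro a b c
      have := h _ (mem_net.2 ⟨a, b, c, rfl⟩)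
      rw [symMat_add, det_symMat, det_symMat] at this
      linear_combination this
    have hβ : β = 0 := by simpa using key 0 (-β) 0
    subst hβ
    have hαγ : α * γ = 0 := by linear_combination key 0 1 0
    have hγ : γ = 0 := by linear_combination key 1 1 0 - hαγ
    have hα : α = 0 := by linear_combination key 0 1 1 - hαγ
    subst hγ hα
    apply hM0
    ext i j
    fin_cases i <;> fin_cases j <;> simp [symMat]
  all_goals exact absurd hk (by decide)

theorem HasKind.hasThreeSquares_iff (h : HasKind ν k W)
    (hk : k = 7 ∨ k = 8 ∨ k = 9) : HasThreeSquares W ↔ k = 7 := by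
  cases h
  case seven =>
    refine iff_of_true ⟨![1, 0, 0], ![0, 1, 0], ![0, 0, 1], ?_, ?_, ?_, ?_⟩ rfl
    · simp [Matrix.det_fin_three]
    all_goals rw [vecMulVec_self, symMat_mem_net]
    exacts [⟨0, 0, by simp⟩, ⟨1, 0, by simp⟩, ⟨0, 1, by simp⟩]
  case eight =>
    have key : ∀ v : Fin 3 → F, vecMulVec v v ∈ hypNet (1 : F) 0 → v 1 = 0 := by
      intro v hv
      rw [vecMulVec_self, symMat_mem_net] at hv
      grind
    refine iff_of_false ?_ (by decide)
    rintro ⟨u, v, w, hd, hu, hv, hw⟩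
    apply hd
    simp [Matrix.det_fin_three, key u hu, key v hv, key w hw]
  case nine =>
    have key : ∀ v : Fin 3 → F, vecMulVec v v ∈ parNet (0 : F) 1 → v 2 = 0 := by
      intro v hv
      rw [vecMulVec_self, symMat_mem_net] at hv
      grind
    refine iff_of_false ?_ (by decide)
    rintro ⟨u, v, w, hd, hu, hv, hw⟩
    apply hd
    simp [Matrix.det_fin_three, key u hu, key v hv, key w hw]
  all_goals exact absurd hk (by decide)

theorem HasKind.eq_of_kEquiv (h2 : (2 : F) ≠ 0) (hν : ∀ s : F, ν ≠ s ^ 2)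
    {W' : Submodule F (Matrix (Fin 3) (Fin 3) F)} {k' : Fin 13}
    (hk : HasKind ν k W) (hk' : HasKind ν k' W') (h : KEquiv F W W') : k = k' := by
  have h' := kEquiv_symm h
  have i₁ : k < 7 ↔ k' < 7 :=
    (hk.hasTangent_iff hν).symm.trans
      (Iff.trans ⟨.of_kEquiv h, .of_kEquiv h'⟩ (hk'.hasTangent_iff hν))
  have i₂ := (hk.hasTwoSquares_iff hν).symm.trans
    (Iff.trans ⟨.of_kEquiv h, .of_kEquiv h'⟩ (hk'.hasTwoSquares_iff hν))
  have i₃ := fun a a' => (hk.isSingular_iff hν a).symm.trans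
    (Iff.trans ⟨.of_kEquiv h, .of_kEquiv h'⟩ (hk'.isSingular_iff hν a'))
  have i₄ := fun a a' => (hk.represents_neg_one_iff hν a).symm.trans
    (Iff.trans ⟨.of_kEquiv h, .of_kEquiv h'⟩ (hk'.represents_neg_one_iff hν a'))
  have i₅ := fun a a' => (hk.represents_neg_iff hν a).symm.trans
    (Iff.trans ⟨.of_kEquiv h, .of_kEquiv h'⟩ (hk'.represents_neg_iff hν a'))
  have i₆ := fun a a' => (hk.isIsotropic_iff hν a).symm.trans
    (Iff.trans ⟨.of_kEquiv h, .of_kEquiv h'⟩ (hk'.isIsotropic_iff hν a'))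
  have i₇ := fun a a' => (hk.hasVertex_iff h2 a).symm.trans
    (Iff.trans ⟨.of_kEquiv h, .of_kEquiv h'⟩ (hk'.hasVertex_iff h2 a'))
  have i₈ := fun a a' => (hk.hasThreeSquares_iff a).symm.trans
    (Iff.trans ⟨.of_kEquiv h, .of_kEquiv h'⟩ (hk'.hasThreeSquares_iff a'))
  clear hk hk' h h' h2 hν
  lia (splits := 30)

end Kinds

section Separation

variable {F : Type*} [Field F]

/-- A converse of `net_kEquiv` for nets containing a single square. -/
theorem exists_of_net_kEquiv {m₁ m₂ p q r n₁ n₂ p' q' r' M₁ M₂ P Q R N₁ N₂ P' Q' R' : F}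
    (hW : HasOneSquare (net M₁ M₂ P Q R N₁ N₂ P' Q' R'))
    (h : KEquiv F (net m₁ m₂ p q r n₁ n₂ p' q' r') (net M₁ M₂ P Q R N₁ N₂ P' Q' R')) :
    ∃ l u₁ u₂ b₁ b₂ b₃ b₄ c₁ c₂ c₃ c₄ : F, l ≠ 0 ∧ b₁ * b₄ - b₂ * b₃ ≠ 0 ∧
      (b₁ * (l * m₁ + p * u₁ + q * u₂) + b₂ * (l * m₂ + q * u₁ + r * u₂) = c₁ * M₁ + c₂ * N₁ ∧
      b₃ * (l * m₁ + p * u₁ + q * u₂) + b₄ * (l * m₂ + q * u₁ + r * u₂) = c₁ * M₂ + c₂ * N₂ ∧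
      b₁ ^ 2 * p + 2 * b₁ * b₂ * q + b₂ ^ 2 * r = c₁ * P + c₂ * P' ∧
      b₁ * b₃ * p + (b₁ * b₄ + b₂ * b₃) * q + b₂ * b₄ * r = c₁ * Q + c₂ * Q' ∧
      b₃ ^ 2 * p + 2 * b₃ * b₄ * q + b₄ ^ 2 * r = c₁ * R + c₂ * R') ∧
      b₁ * (l * n₁ + p' * u₁ + q' * u₂) + b₂ * (l * n₂ + q' * u₁ + r' * u₂)
        = c₃ * M₁ + c₄ * N₁ ∧
      b₃ * (l * n₁ + p' * u₁ + q' * u₂) + b₄ * (l * n₂ + q' * u₁ + r' * u₂)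
        = c₃ * M₂ + c₄ * N₂ ∧
      b₁ ^ 2 * p' + 2 * b₁ * b₂ * q' + b₂ ^ 2 * r' = c₃ * P + c₄ * P' ∧
      b₁ * b₃ * p' + (b₁ * b₄ + b₂ * b₃) * q' + b₂ * b₄ * r' = c₃ * Q + c₄ * Q' ∧
      b₃ ^ 2 * p' + 2 * b₃ * b₄ * q' + b₄ ^ 2 * r' = c₃ * R + c₄ * R' := by
  obtain ⟨A, hA, h₁, -⟩ := exists_of_kEquiv h
  obtain ⟨hA₁, hA₂⟩ : A 1 0 = 0 ∧ A 2 0 = 0 := by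
    have := hW (A *ᵥ ![1, 0, 0])
      (by simpa only [mul_vecMulVec_mul] using h₁ _ vecMulVec_one_mem_net)
    simpa [Matrix.mulVec, dotProduct, Fin.sum_univ_three] using this
  have hdet : A 0 0 ≠ 0 ∧ A 1 1 * A 2 2 - A 1 2 * A 2 1 ≠ 0 := by
    rw [← mul_ne_zero_iff]
    convert hA using 1
    rw [Matrix.det_fin_three, hA₁, hA₂]
    ring
  have key : ∀ x₁ x₂ y₁ y₂ y₃ : F, A * symMat 0 x₁ x₂ y₁ y₂ y₃ * Aᵀ =
      symMat (2 * A 0 0 * (A 0 1 * x₁ + A 0 2 * x₂) + A 0 1 ^ 2 * y₁ + 2 * A 0 1 * A 0 2 * y₂ +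
          A 0 2 ^ 2 * y₃)
        (A 1 1 * (A 0 0 * x₁ + y₁ * A 0 1 + y₂ * A 0 2) +
          A 1 2 * (A 0 0 * x₂ + y₂ * A 0 1 + y₃ * A 0 2))
        (A 2 1 * (A 0 0 * x₁ + y₁ * A 0 1 + y₂ * A 0 2) +
          A 2 2 * (A 0 0 * x₂ + y₂ * A 0 1 + y₃ * A 0 2))
        (A 1 1 ^ 2 * y₁ + 2 * A 1 1 * A 1 2 * y₂ + A 1 2 ^ 2 * y₃)
        (A 1 1 * A 2 1 * y₁ + (A 1 1 * A 2 2 + A 1 2 * A 2 1) * y₂ + A 1 2 * A 2 2 * y₃)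
        (A 2 1 ^ 2 * y₁ + 2 * A 2 1 * A 2 2 * y₂ + A 2 2 ^ 2 * y₃) := by
    intro x₁ x₂ y₁ y₂ y₃
    ext i j
    fin_cases i <;> fin_cases j <;>
      simp [symMat, Matrix.mul_apply, Fin.sum_univ_three, hA₁, hA₂] <;> ring
  have hM := h₁ (symMat 0 m₁ m₂ p q r) (Submodule.subset_span (by simp))
  have hN := h₁ (symMat 0 n₁ n₂ p' q' r') (Submodule.subset_span (by simp))
  rw [key, symMat_mem_net] at hM hN
  obtain ⟨c₁, c₂, e₁, e₂, e₃, e₄, e₅⟩ := hM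
  obtain ⟨c₃, c₄, f₁, f₂, f₃, f₄, f₅⟩ := hN
  exact ⟨_, _, _, _, _, _, _, c₁, c₂, c₃, c₄, hdet.1, hdet.2,
    ⟨e₁.symm, e₂.symm, e₃.symm, e₄.symm, e₅.symm⟩,
    f₁.symm, f₂.symm, f₃.symm, f₄.symm, f₅.symm⟩

theorem exists_eq_pow_three_of_hypNet_kEquiv {g : F}
    (hW : HasOneSquare (hypNet 1 g)) (h : KEquiv F (hypNet 1 1) (hypNet 1 g)) :
    ∃ y, g = y ^ 3 := by
  obtain ⟨l, u₁, u₂, b₁, b₂, b₃, b₄, c₁, c₂, c₃, c₄, hl, hb, ⟨e₁, e₂, e₃, e₄, e₅⟩,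
    f₁, f₂, f₃, f₄, f₅⟩ := exists_of_net_kEquiv hW h
  simp only [mul_zero, mul_one, zero_mul, add_zero, zero_add, one_mul, mul_eq_zero]
    at e₁ e₂ e₃ e₄ e₅ f₁ f₂ f₃ f₄ f₅
  subst e₃ e₅ f₃ f₅
  rcases e₄ with rfl | rfl
  · have hb₂ : b₂ ≠ 0 := by rintro rfl; simp at hb
    have hb₃ : b₃ ≠ 0 := by rintro rfl; simp at hb
    have hb₄ : b₄ = 0 := f₄.resolve_left hb₂
    subst hb₄
    refine ⟨b₂ / b₃, ?_⟩
    field_simp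
    linear_combination b₂ * f₂ - b₃ * e₁
  · have hb₁ : b₁ ≠ 0 := by rintro rfl; simp at hb
    have hb₄ : b₄ ≠ 0 := by rintro rfl; simp at hb
    have hb₂ : b₂ = 0 := f₄.resolve_right hb₄
    subst hb₂
    refine ⟨b₁ / b₄, ?_⟩
    field_simp
    linear_combination b₁ * e₂ - b₄ * f₁

theorem not_parNet_kEquiv (h3 : (3 : F) = 0) (hW : HasOneSquare (parNet (1 : F) 1)) :
    ¬ KEquiv F (parNet (1 : F) 0) (parNet 1 1) := by
  intro h
  obtain ⟨l, u₁, u₂, b₁, b₂, b₃, b₄, c₁, c₂, c₃, c₄, hl, hb, ⟨e₁, e₂, e₃, e₄, e₅⟩,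
    f₁, f₂, f₃, f₄, f₅⟩ := exists_of_net_kEquiv hW h
  simp only [mul_zero, mul_one, zero_mul, add_zero, zero_add, one_mul]
    at e₁ e₂ e₃ e₄ e₅ f₁ f₂ f₃ f₄ f₅
  have hb₃ : b₃ = 0 := by simpa using e₅
  subst hb₃
  simp only [mul_zero, sub_zero, add_zero, zero_mul, zero_add] at *
  subst e₃ e₄ f₃ f₄
  apply hb
  have hb₁ : b₁ ≠ 0 := by rintro rfl; simp at hb
  apply mul_left_cancel₀ hb₁
  linear_combination b₄ * e₁ - b₂ * e₂ - b₁ * f₂ - b₁ ^ 2 * b₂ * h3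

theorem exists_of_ellNet_kEquiv {ν x y x' y' : F} (h2 : (2 : F) ≠ 0) (hν : ∀ s : F, ν ≠ s ^ 2)
    (h : KEquiv F (ellNet ν x y) (ellNet ν x' y')) :
    ∃ m k₀ k₁ : F, m ≠ 0 ∧
      m * ((k₀ ^ 3 + 3 * ν * k₀ * k₁ ^ 2) * x + ν * (3 * k₀ ^ 2 * k₁ + ν * k₁ ^ 3) * y) = x' ∧
      (m * ((k₀ ^ 3 + 3 * ν * k₀ * k₁ ^ 2) * y + (3 * k₀ ^ 2 * k₁ + ν * k₁ ^ 3) * x) = y' ∨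
      m * ((k₀ ^ 3 + 3 * ν * k₀ * k₁ ^ 2) * y + (3 * k₀ ^ 2 * k₁ + ν * k₁ ^ 3) * x) = -y') := by
  have hν0 : ν ≠ 0 := by simpa using hν 0
  obtain ⟨l, u₁, u₂, b₁, b₂, b₃, b₄, c₁, c₂, c₃, c₄, hl, hb, ⟨e₁, e₂, e₃, e₄, e₅⟩,
    f₁, f₂, f₃, f₄, f₅⟩ := exists_of_net_kEquiv
      ((HasKind.twelve (ν := ν) x' y').hasOneSquare hν (by decide)) h
  simp only [mul_zero, mul_one, zero_mul, add_zero, zero_add]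
    at e₁ e₂ e₃ e₄ e₅ f₁ f₂ f₃ f₄ f₅
  have hN : b₄ ^ 2 - ν * b₃ ^ 2 ≠ 0 := by
    intro h0
    obtain ⟨h₁, h₂⟩ := eq_zero_of_sq_eq_mul_sq hν (sub_eq_zero.1 h0)
    simp [h₁, h₂] at hb
  subst e₄ e₅ f₄
  have hc₃ : c₃ = 2 * b₃ * b₄ := f₅.symm
  subst hc₃
  have hε : (b₁ = b₄ ∧ b₂ = ν * b₃) ∨ (b₁ = -b₄ ∧ b₂ = -(ν * b₃)) := by
    have h₁ : b₁ * b₂ = ν * b₃ * b₄ := by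
      apply mul_left_cancel₀ h2
      linear_combination f₃
    have h₂ : ν * (b₄ ^ 2 - b₁ ^ 2) * (b₁ ^ 2 - ν * b₃ ^ 2) = 0 := by
      linear_combination (b₁ * b₂ + ν * b₃ * b₄) * h₁ - b₁ ^ 2 * e₃
    rcases mul_eq_zero.1 h₂ with h₃ | h₃
    · have h₄ : b₁ ^ 2 = b₄ ^ 2 := by
        apply mul_left_cancel₀ hν0
        linear_combination -h₃
      have h₅ : b₂ ^ 2 = (ν * b₃) ^ 2 := by linear_combination e₃ - ν * h₄
      rcases sq_eq_sq_iff_eq_or_eq_neg.1 h₄ with h₄ | h₄ <;>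
      rcases sq_eq_sq_iff_eq_or_eq_neg.1 h₅ with h₅ | h₅ <;>
      grind
    · obtain ⟨rfl, rfl⟩ := eq_zero_of_sq_eq_mul_sq hν (sub_eq_zero.1 h₃)
      obtain ⟨rfl, rfl⟩ := eq_zero_of_sq_eq_mul_sq (a := b₂) (b := b₄) hν
        (by linear_combination e₃)
      simp at hN
  refine ⟨l / (b₄ ^ 2 - ν * b₃ ^ 2) ^ 2, b₄, b₃, by simp [hl, hN], ?_⟩
  rcases hε with ⟨rfl, rfl⟩ | ⟨rfl, rfl⟩
  · have g₁ : l * (b₁ * y + b₃ * x) = (b₁ ^ 2 + ν * b₃ ^ 2) * y' - 2 * b₁ * b₃ * x' := by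
      apply mul_left_cancel₀ (mul_ne_zero h2 hν0)
      linear_combination e₁ - ν * f₂
    have g₂ : l * (ν * b₃ * y + b₁ * x) = (b₁ ^ 2 + ν * b₃ ^ 2) * x' - 2 * ν * b₁ * b₃ * y' := by
      apply mul_left_cancel₀ h2
      linear_combination e₂ - f₁
    refine ⟨?_, Or.inl ?_⟩ <;> rw [div_mul_eq_mul_div, div_eq_iff (pow_ne_zero 2 hN)]
    · linear_combination (b₁ ^ 2 + ν * b₃ ^ 2) * g₂ + 2 * ν * b₁ * b₃ * g₁
    · linear_combination (b₁ ^ 2 + ν * b₃ ^ 2) * g₁ + 2 * b₁ * b₃ * g₂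
  · have g₁ : l * (b₄ * y + b₃ * x) = -(b₄ ^ 2 + ν * b₃ ^ 2) * y' - 2 * b₄ * b₃ * x' := by
      apply mul_left_cancel₀ (mul_ne_zero h2 hν0)
      linear_combination -e₁ - ν * f₂
    have g₂ : l * (ν * b₃ * y + b₄ * x) = (b₄ ^ 2 + ν * b₃ ^ 2) * x' + 2 * ν * b₄ * b₃ * y' := by
      apply mul_left_cancel₀ h2
      linear_combination e₂ + f₁
    refine ⟨?_, Or.inr ?_⟩ <;> rw [div_mul_eq_mul_div, div_eq_iff (pow_ne_zero 2 hN)]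
    · linear_combination (b₄ ^ 2 + ν * b₃ ^ 2) * g₂ + 2 * ν * b₄ * b₃ * g₁
    · linear_combination (b₄ ^ 2 + ν * b₃ ^ 2) * g₁ + 2 * b₄ * b₃ * g₂

end Separation

section Distinct

variable {F : Type*} [Field F] {ν : F}

theorem eq_zero_of_ellNet_zero_kEquiv {x y : F} (h2 : (2 : F) ≠ 0) (hν : ∀ s : F, ν ≠ s ^ 2)
    (h : KEquiv F (ellNet ν 0 0) (ellNet ν x y)) : x = 0 ∧ y = 0 := by
  obtain ⟨m, k₀, k₁, hm, hx, hy⟩ := exists_of_ellNet_kEquiv h2 hν h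
  simp only [mul_zero, add_zero] at hx hy
  exact ⟨hx.symm, by simpa [eq_comm] using hy⟩

theorem exists_eq_smul_pow_three_of_ellNet_kEquiv (h2 : (2 : F) ≠ 0) (hν : ∀ s : F, ν ≠ s ^ 2)
    {γ : QuadraticAlgebra F ν 0} (h : KEquiv F (ellNet ν 1 0) (ellNet ν γ.re γ.im)) :
    ∃ (m : F) (κ : QuadraticAlgebra F ν 0), m ≠ 0 ∧ γ = m • κ ^ 3 := by
  obtain ⟨m, k₀, k₁, hm, hx, hy | hy⟩ := exists_of_ellNet_kEquiv h2 hν h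
  · refine ⟨m, ⟨k₀, k₁⟩, hm, ?_⟩
    ext
    · simp [pow_succ]
      linear_combination -hx
    · simp [pow_succ]
      linear_combination -hy
  · refine ⟨m, ⟨k₀, -k₁⟩, hm, ?_⟩
    ext
    · simp [pow_succ]
      linear_combination -hx
    · simp [pow_succ]
      linear_combination hy

/-- The kinds of the representatives, given the kind of the exceptional one. -/
def repKind (k : Fin 13) : Fin 15 → Fin 13 :=
  ![0, 2, 3, 4, 5, 1, 6, 7, 8, 12, 9, 11, 10, 12, k]

theorem repKind_eq : ∀ k : Fin 13, 10 ≤ k → ∀ i j, i < j → repKind k i = repKind k j →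
    i = 9 ∧ j = 13 ∨ k = 10 ∧ i = 12 ∧ j = 14 ∨ k = 11 ∧ i = 11 ∧ j = 14 ∨
      k = 12 ∧ (i = 9 ∨ i = 13) ∧ j = 14 := by
  decide

theorem hasKind_reps {k : Fin 13} {X : Submodule F (Matrix (Fin 3) (Fin 3) F)}
    (hX : HasKind ν k X) (i : Fin 15) : HasKind ν (repKind k i) (reps ν X i) := by
  fin_cases i
  exacts [.zero, .two, .three, .four, .five, .one, .six, .seven, .eight, .twelve 0 0, .nine,
    .eleven 1 0 one_ne_zero, .ten 1 1 one_ne_zero one_ne_zero, .twelve 1 0, hX]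

theorem not_reps_kEquiv_of_lt (h2 : (2 : F) ≠ 0) (hν : ∀ s : F, ν ≠ s ^ 2)
    {X : Submodule F (Matrix (Fin 3) (Fin 3) F)} (hX : IsExceptional ν X) {i j : Fin 15}
    (hij : i < j) : ¬ KEquiv F (reps ν X i) (reps ν X j) := by
  intro h
  have h₀ : ¬ KEquiv F (ellNet ν 0 0) (ellNet ν 1 0) := fun h =>
    one_ne_zero (eq_zero_of_ellNet_zero_kEquiv h2 hν h).1
  have key : ∀ k : Fin 13, HasKind ν k X → 10 ≤ k → i = 9 ∧ j = 13 ∨ k = 10 ∧ i = 12 ∧ j = 14 ∨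
      k = 11 ∧ i = 11 ∧ j = 14 ∨ k = 12 ∧ (i = 9 ∨ i = 13) ∧ j = 14 := fun k hk hk' =>
    repKind_eq k hk' i j hij ((hasKind_reps hk i).eq_of_kEquiv h2 hν (hasKind_reps hk j) h)
  cases hX with
  | par h3 =>
    have hk : HasKind ν 11 (parNet (1 : F) 1) := .eleven 1 1 one_ne_zero
    rcases key 11 hk (by decide) with ⟨rfl, rfl⟩ | ⟨h', -⟩ | ⟨-, rfl, rfl⟩ | ⟨h', -⟩
    · exact h₀ h
    · exact absurd h' (by decide)
    · exact not_parNet_kEquiv h3 (hk.hasOneSquare hν (by decide)) h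
    · exact absurd h' (by decide)
  | hyp g hg hc =>
    have hk : HasKind ν 10 (hypNet 1 g) := .ten 1 g one_ne_zero hg
    rcases key 10 hk (by decide) with ⟨rfl, rfl⟩ | ⟨-, rfl, rfl⟩ | ⟨h', -⟩ | ⟨h', -⟩
    · exact h₀ h
    · obtain ⟨y, hy⟩ := exists_eq_pow_three_of_hypNet_kEquiv
        (hk.hasOneSquare hν (by decide)) h
      exact hc y hy
    · exact absurd h' (by decide)
    · exact absurd h' (by decide)
  | ell γ hγ hc =>
    rcases key 12 (.twelve _ _) (by decide) with
      ⟨rfl, rfl⟩ | ⟨h', -⟩ | ⟨h', -⟩ | ⟨-, rfl | rfl, rfl⟩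
    · exact h₀ h
    · exact absurd h' (by decide)
    · exact absurd h' (by decide)
    · obtain ⟨hr, hi⟩ := eq_zero_of_ellNet_zero_kEquiv h2 hν h
      exact hγ (QuadraticAlgebra.ext hr hi)
    · obtain ⟨m, κ, hm, e⟩ := exists_eq_smul_pow_three_of_ellNet_kEquiv h2 hν h
      exact hc m κ hm e

end Distinct

end NetsOfConics

/-- There are exactly 15 `K`-equivalence classes of 3-dimensional subspaces of the space
of symmetric `3 × 3` matrices over a finite field `F` of odd order that contain a nonzero
matrix of rank 1 (i.e. 15 orbits of planes of `PG(5,q)` meeting the quadric Veronesean). -/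
theorem fifteen_orbits_of_planes_meeting_veronesean (F : Type*) [Field F] [Fintype F]
    (hodd : Odd (Fintype.card F)) :
    ∃ R : Fin 15 → Submodule F (Matrix (Fin 3) (Fin 3) F),
      (∀ i, (∀ M ∈ R i, M.IsSymm) ∧ Module.finrank F ↥(R i) = 3 ∧
        (∃ M ∈ R i, M ≠ 0 ∧ M.rank = 1)) ∧
      (∀ i j, KEquiv F (R i) (R j) → i = j) ∧
      (∀ W : Submodule F (Matrix (Fin 3) (Fin 3) F),
        (∀ M ∈ W, M.IsSymm) → Module.finrank F ↥W = 3 →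
        (∃ M ∈ W, M ≠ 0 ∧ M.rank = 1) →
        ∃ i, KEquiv F W (R i)) := by
  obtain ⟨h2, ν, hns, hν⟩ := NetsOfConics.exists_nonsquare_of_odd hodd
  obtain ⟨X, hX, hall⟩ := NetsOfConics.exists_isExceptional h2 hns hν
  refine ⟨NetsOfConics.reps ν X, fun i => ?_, fun i j h => ?_, fun W hW h3 h1 => ?_⟩
  · obtain ⟨m₁, m₂, p, q, r, n₁, n₂, p', q', r', h, hind⟩ := NetsOfConics.exists_reps_eq_net hX i
    rw [h]
    exact ⟨fun M hM => NetsOfConics.isSymm_of_mem_net hM, NetsOfConics.finrank_net hind, _,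
      NetsOfConics.symMat_one_mem_net _ _ _ _ _ _ _ _ _ _,
      NetsOfConics.symMat_ne_zero (Or.inl one_ne_zero), NetsOfConics.rank_symMat_one⟩
  · rcases lt_trichotomy i j with hij | hij | hij
    · exact absurd h (NetsOfConics.not_reps_kEquiv_of_lt h2 hns hX hij)
    · exact hij
    · exact absurd (NetsOfConics.kEquiv_symm h) (NetsOfConics.not_reps_kEquiv_of_lt h2 hns hX hij)
  · obtain ⟨M, hM, -, hr⟩ := h1
    obtain ⟨m₁, m₂, p, q, r, n₁, n₂, p', q', r', h, hind⟩ :=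
      NetsOfConics.exists_net_kEquiv hW h3 ⟨M, hM, hr⟩
    obtain ⟨i, hi⟩ := hall _ _ _ _ _ _ _ _ _ _ hind
    exact ⟨i, NetsOfConics.kEquiv_trans h hi⟩
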